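/- arXiv:1110.2389 — 7 statements merged into one kernel-verified Lean document; each statement's English description precedes it below -/
import Mathlib

section
/- Let L be a finite-dimensional metabelian Lie algebra over a field F and suppose that dim L² = k. Then dim(L/C_L(L²)) ≤ ⌊k²/4⌋ + 1, where C_L(L²) denotes the centralizer of L² in L. -/
open Module

/-- The centralizer `C_L(S) = {x ∈ L : [x,S] = 0}` of a subset `S` of `L`, as a subspace. -/
def lieCentralizer (F L : Type*) [Field F] [LieRing L] [LieAlgebra F L]
    (S : Set L) : Submodule F L where
  carrier := {x | ∀ y ∈ S, ⁅x, y⁆ = 0}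
  zero_mem' := by intro y _; simp
  add_mem' := by
    intro a b ha hb y hy
    rw [Set.mem_setOf_eq] at ha hb
    rw [add_lie, ha y hy, hb y hy, add_zero]
  smul_mem' := by
    intro c a ha y hy
    rw [Set.mem_setOf_eq] at ha
    rw [smul_lie, ha y hy, smul_zero]

open IsLocalRing

section CommutativeAlgebra

variable {F A V : Type*} [Field F] [CommRing A] [Algebra F A]
  [AddCommGroup V] [Module F V] [Module A V] [IsScalarTower F A V]

theorem finrank_submodule_add_finrank_quotient_of_tower [FiniteDimensional F V]
    (N : Submodule A V) : finrank F N + finrank F (V ⧸ N) = finrank F V := by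
  rw [← (N.mkQ.restrictScalars F).finrank_range_add_finrank_ker, add_comm]
  congr 1
  · rw [(LinearMap.range_eq_top (f := N.mkQ.restrictScalars F)).mpr N.mkQ_surjective, finrank_top]
  · rw [LinearMap.ker_restrictScalars, N.ker_mkQ]
    rfl

theorem finiteDimensional_of_faithfulSMul (F A V : Type*) [Field F] [CommRing A] [Algebra F A]
    [AddCommGroup V] [Module F V] [Module A V] [IsScalarTower F A V]
    [FiniteDimensional F V] [FaithfulSMul A V] : FiniteDimensional F A := by
  refine FiniteDimensional.of_injective (Algebra.lsmul F F V : A →ₐ[F] End F V).toLinearMap ?_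
  intro a b hab
  exact FaithfulSMul.eq_of_smul_eq_smul fun v : V => LinearMap.congr_fun hab v

theorem eq_zero_of_smul_eq_zero_of_span_eq_top [FaithfulSMul A V] {s : Set V}
    (hs : Submodule.span A s = ⊤) {a : A} (ha : ∀ v ∈ s, a • v = 0) : a = 0 := by
  have h : s ⊆ LinearMap.ker (LinearMap.lsmul A V a) := fun v hv => ha v hv
  refine FaithfulSMul.eq_of_smul_eq_smul fun v : V => ?_
  have hv := Submodule.span_le.mpr h (hs ▸ Submodule.mem_top : v ∈ Submodule.span A s)
  simpa using hv

theorem add_mul_le_sq_div_four_add_one {d s u : ℕ} (hd : 1 ≤ d) (hs : 1 ≤ s) :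
    d + s * u ≤ (u + d * s) ^ 2 / 4 + 1 := by
  have h : 4 * (d + s * u) ≤ (u + d * s) ^ 2 + 4 := by
    obtain ⟨d, rfl⟩ := Nat.exists_eq_add_of_le hd
    obtain ⟨s, rfl⟩ := Nat.exists_eq_add_of_le hs
    zify
    nlinarith [sq_nonneg ((u : ℤ) + (1 + d) * (1 + s) - 2 * (1 + s)),
      (by positivity : (0 : ℤ) ≤ d * (s * (s + 2)))]
  omega

theorem finrank_le_sq_div_four_add_one_of_isLocalRing [FiniteDimensional F V]
    [FaithfulSMul A V] [IsLocalRing A] : finrank F A ≤ finrank F V ^ 2 / 4 + 1 := by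
  have : FiniteDimensional F A := finiteDimensional_of_faithfulSMul F A V
  have : Module.Finite A V := Module.Finite.of_restrictScalars_finite F A V
  let : Field (A ⧸ maximalIdeal A) := Ideal.Quotient.field _
  set N : Submodule A V := maximalIdeal A • ⊤
  have : IsScalarTower F (A ⧸ maximalIdeal A) (V ⧸ N) := by
    refine ⟨fun c x v => ?_⟩
    obtain ⟨a, rfl⟩ := Ideal.Quotient.mk_surjective x
    obtain ⟨v, rfl⟩ := N.mkQ_surjective v
    exact congrArg N.mkQ (smul_assoc c a v)
  have : FiniteDimensional (A ⧸ maximalIdeal A) (V ⧸ N) :=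
    Module.Finite.of_restrictScalars_finite A _ _
  let b := finBasis (A ⧸ maximalIdeal A) (V ⧸ N)
  choose v hv using fun i => N.mkQ_surjective (b i)
  have hspan : Submodule.span A (Set.range v) = ⊤ := by
    rw [← map_mkQ_eq_top, Submodule.map_span, ← Set.range_comp,
      show N.mkQ ∘ v = b from funext hv,
      ← Submodule.restrictScalars_span A (A ⧸ maximalIdeal A) Ideal.Quotient.mk_surjective,
      b.span_eq, Submodule.restrictScalars_top]
  have hs : 1 ≤ finrank (A ⧸ maximalIdeal A) (V ⧸ N) := by
    by_contra! h
    have : IsEmpty (Fin (finrank (A ⧸ maximalIdeal A) (V ⧸ N))) := by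
      rw [Nat.lt_one_iff.mp h]; infer_instance
    exact one_ne_zero (eq_zero_of_smul_eq_zero_of_span_eq_top hspan (a := (1 : A)) (by simp))
  let φ : maximalIdeal A →ₗ[F] (Fin (finrank (A ⧸ maximalIdeal A) (V ⧸ N)) → N) :=
    { toFun a i := ⟨(a : A) • v i, Submodule.smul_mem_smul a.2 Submodule.mem_top⟩
      map_add' a b := by ext i; simp [add_smul]
      map_smul' c a := by ext i; simp }
  have hφ : Function.Injective φ := by
    rw [← LinearMap.ker_eq_bot, LinearMap.ker_eq_bot']
    intro a ha
    refine Subtype.ext (eq_zero_of_smul_eq_zero_of_span_eq_top hspan ?_)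
    rintro _ ⟨i, rfl⟩
    exact congrArg Subtype.val (congrFun ha i)
  have : FiniteDimensional F N :=
    FiniteDimensional.of_injective (N.subtype.restrictScalars F) N.subtype_injective
  have h₁ := LinearMap.finrank_le_finrank_of_injective hφ
  rw [finrank_pi_fintype, Finset.sum_const, Finset.card_univ, Fintype.card_fin, smul_eq_mul] at h₁
  have h₂ := finrank_submodule_add_finrank_quotient_of_tower (F := F) N
  have h₃ := finrank_submodule_add_finrank_quotient_of_tower (F := F) (maximalIdeal A)
  rw [← finrank_mul_finrank F (A ⧸ maximalIdeal A) (V ⧸ N)] at h₂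
  have h₄ := add_mul_le_sq_div_four_add_one (u := finrank F N)
    (finrank_pos (R := F) (M := A ⧸ maximalIdeal A)) hs
  rw [h₂] at h₄
  omega

theorem exists_isCompl_ne_bot_of_not_isLocalRing [FiniteDimensional F V] [FaithfulSMul A V]
    [Nontrivial A] (hA : ¬ IsLocalRing A) : ∃ p q : Submodule A V, IsCompl p q ∧ p ≠ ⊥ ∧ q ≠ ⊥ := by
  have : FiniteDimensional F A := finiteDimensional_of_faithfulSMul F A V
  have : IsArtinianRing A := isArtinian_of_tower F inferInstance
  have : Module.Finite A V := Module.Finite.of_restrictScalars_finite F A V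
  obtain ⟨a, ha, ha'⟩ : ∃ a : A, ¬ IsUnit a ∧ ¬ IsUnit (1 - a) := by
    contrapose! hA
    exact .of_isUnit_or_isUnit_one_sub_self fun a => or_iff_not_imp_left.mpr (hA a)
  have hpow (n : ℕ) (v : V) : (LinearMap.lsmul A V a ^ n) v = a ^ n • v := by
    induction n generalizing v with
    | zero => simp
    | succ n ih => rw [pow_succ, End.mul_apply, ih, LinearMap.lsmul_apply, smul_smul, pow_succ]
  obtain ⟨n, hn, hn'⟩ := ((LinearMap.lsmul A V a).eventually_isCompl_ker_pow_range_pow.and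
    (Filter.eventually_ge_atTop 1)).exists
  refine ⟨_, _, hn, fun h => ha ?_, fun h => ha' ?_⟩
  · refine (isUnit_pow_iff (n := n) (by omega)).mp
      (IsArtinianRing.isUnit_of_mem_nonZeroDivisors (mem_nonZeroDivisors_iff_right.mpr ?_))
    intro x hx
    refine FaithfulSMul.eq_of_smul_eq_smul fun v : V => ?_
    rw [zero_smul]
    refine (LinearMap.ker_eq_bot'.mp h) _ ?_
    rw [hpow, smul_smul, mul_comm, hx, zero_smul]
  · refine IsNilpotent.isUnit_one_sub ⟨n, FaithfulSMul.eq_of_smul_eq_smul fun v : V => ?_⟩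
    rw [← hpow, LinearMap.range_eq_bot.mp h, zero_smul, LinearMap.zero_apply]

theorem sq_div_four_add_sq_div_four_add_one_le {a b : ℕ} (ha : 1 ≤ a) (hb : 1 ≤ b) :
    a ^ 2 / 4 + b ^ 2 / 4 + 1 ≤ (a + b) ^ 2 / 4 := by
  have h : a ^ 2 / 4 + b ^ 2 / 4 + (a * b) / 2 ≤ (a + b) ^ 2 / 4 := by
    rw [show (a + b) ^ 2 = a ^ 2 + b ^ 2 + 2 * (a * b) by ring]
    omega
  rcases le_or_gt 2 (a * b) with h' | h'
  · omega
  · obtain ⟨rfl, rfl⟩ : a = 1 ∧ b = 1 := mul_eq_one.mp (by nlinarith [Nat.mul_pos ha hb])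
    norm_num

/-- The **Schur–Jacobson bound**: a commutative algebra acting faithfully on an `n`-dimensional
vector space has dimension at most `⌊n²/4⌋ + 1`. -/
theorem finrank_le_sq_div_four_add_one_of_faithfulSMul [FiniteDimensional F V]
    [FaithfulSMul A V] : finrank F A ≤ finrank F V ^ 2 / 4 + 1 := by
  induction hn : finrank F V using Nat.strong_induction_on generalizing A V with
  | _ n ih =>
  have : FiniteDimensional F A := finiteDimensional_of_faithfulSMul F A V
  subst hn
  rcases subsingleton_or_nontrivial A with hA | hA
  · simp [finrank_zero_of_subsingleton]
  by_cases hA : IsLocalRing A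
  · exact finrank_le_sq_div_four_add_one_of_isLocalRing
  obtain ⟨p, q, hpq, hp, hq⟩ := exists_isCompl_ne_bot_of_not_isLocalRing (F := F) (V := V) hA
  have hfin (r : Submodule A V) : FiniteDimensional F r :=
    FiniteDimensional.of_injective (r.subtype.restrictScalars F) r.subtype_injective
  have hpos (r : Submodule A V) (hr : r ≠ ⊥) : 0 < finrank F r := by
    have := Submodule.nontrivial_iff_ne_bot.mpr hr
    exact finrank_pos
  have hdim : finrank F p + finrank F q = finrank F V := by
    rw [← finrank_prod]
    exact ((Submodule.prodEquivOfIsCompl p q hpq).restrictScalars F).finrank_eq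
  have key (r : Submodule A V) (hr : finrank F r < finrank F V) :
      finrank F (A ⧸ annihilator A r) ≤ finrank F r ^ 2 / 4 + 1 := by
    let := quotientAnnihilator (R := A) (M := r)
    have : IsScalarTower F (A ⧸ annihilator A r) r := by
      refine ⟨fun c x v => ?_⟩
      obtain ⟨a, rfl⟩ := Ideal.Quotient.mk_surjective x
      exact smul_assoc c a v
    have : FaithfulSMul (A ⧸ annihilator A r) r := by
      refine ⟨fun {x y} h => ?_⟩
      obtain ⟨a, rfl⟩ := Ideal.Quotient.mk_surjective x
      obtain ⟨b, rfl⟩ := Ideal.Quotient.mk_surjective y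
      refine Ideal.Quotient.eq.mpr (mem_annihilator.mpr fun v => ?_)
      rw [sub_smul, sub_eq_zero]
      exact h v
    exact ih _ hr rfl
  have hinj : Function.Injective (((annihilator A p).mkQ.restrictScalars F).prod
      ((annihilator A q).mkQ.restrictScalars F)) := by
    rw [← LinearMap.ker_eq_bot, LinearMap.ker_eq_bot']
    intro a ha
    have hap := mem_annihilator.mp ((Submodule.Quotient.mk_eq_zero _).mp (congrArg Prod.fst ha))
    have haq := mem_annihilator.mp ((Submodule.Quotient.mk_eq_zero _).mp (congrArg Prod.snd ha))
    refine FaithfulSMul.eq_of_smul_eq_smul fun v : V => ?_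
    obtain ⟨x, hx, y, hy, rfl⟩ :=
      Submodule.mem_sup.mp (hpq.sup_eq_top ▸ Submodule.mem_top : v ∈ p ⊔ q)
    rw [zero_smul, smul_add, show a • x = 0 from congrArg Subtype.val (hap ⟨x, hx⟩),
      show a • y = 0 from congrArg Subtype.val (haq ⟨y, hy⟩), add_zero]
  have hle := LinearMap.finrank_le_finrank_of_injective hinj
  rw [finrank_prod] at hle
  have := hpos p hp
  have := hpos q hq
  have := key p (by omega)
  have := key q (by omega)
  have := sq_div_four_add_sq_div_four_add_one_le (hpos p hp) (hpos q hq)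
  rw [hdim] at this
  omega

end CommutativeAlgebra

open scoped IsMulCommutative in
/-- A linear map into the endomorphisms of an `n`-dimensional space with pairwise commuting values
has rank at most `⌊n²/4⌋ + 1`. -/
theorem finrank_range_le_of_forall_commute {F M V : Type*} [Field F] [AddCommGroup M] [Module F M]
    [AddCommGroup V] [Module F V] [FiniteDimensional F V] (f : M →ₗ[F] End F V)
    (hf : ∀ x y, Commute (f x) (f y)) :
    finrank F (LinearMap.range f) ≤ finrank F V ^ 2 / 4 + 1 := by
  have := Algebra.isMulCommutative_adjoin F (s := Set.range f) (by
    rintro _ ⟨x, rfl⟩ _ ⟨y, rfl⟩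
    exact hf x y)
  have : FaithfulSMul (Algebra.adjoin F (Set.range f)) V :=
    ⟨fun h => Subtype.ext (LinearMap.ext h)⟩
  refine le_trans ?_ (finrank_le_sq_div_four_add_one_of_faithfulSMul (F := F)
    (A := Algebra.adjoin F (Set.range f)))
  exact Submodule.finrank_mono
    (t := Subalgebra.toSubmodule (Algebra.adjoin F (Set.range f))) Algebra.subset_adjoin

/-- If `L` is a finite-dimensional metabelian Lie algebra over a field `F`
with `dim L² = k`, then `dim (L / C_L(L²)) ≤ ⌊k²/4⌋ + 1`. -/
theorem dim_quotient_centralizer_derived_le (F L : Type*) [Field F] [LieRing L]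
    [LieAlgebra F L] [FiniteDimensional F L]
    (hmeta : IsLieAbelian (LieAlgebra.derivedSeries F L 1))
    (k : ℕ) (hk : Module.finrank F (LieAlgebra.derivedSeries F L 1) = k) :
    Module.finrank F (L ⧸ lieCentralizer F L (LieAlgebra.derivedSeries F L 1 : Set L)) ≤
      k ^ 2 / 4 + 1 := by
  subst hk
  let ρ : L →ₗ[F] End F (LieAlgebra.derivedSeries F L 1) :=
    (LieModule.toEnd F L (LieAlgebra.derivedSeries F L 1) : L →ₗ[F] _)
  have hker : lieCentralizer F L (LieAlgebra.derivedSeries F L 1 : Set L) = LinearMap.ker ρ := by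
    ext x
    refine ⟨fun hx => LinearMap.ext fun y => Subtype.ext (hx y y.2), fun hx y hy => ?_⟩
    exact congrArg Subtype.val (LinearMap.congr_fun hx ⟨y, hy⟩)
  rw [hker, ρ.quotKerEquivRange.finrank_eq]
  refine finrank_range_le_of_forall_commute ρ fun x y => ?_
  have hxy : ⁅x, y⁆ ∈ LieAlgebra.derivedSeries F L 1 :=
    LieSubmodule.lie_mem_lie (LieSubmodule.mem_top x) (LieSubmodule.mem_top y)
  refine LinearMap.ext fun z => ?_
  have h := leibniz_lie x y z
  rwa [show ⁅⁅x, y⁆, z⁆ = 0 from hmeta.trivial ⟨_, hxy⟩ z, zero_add] at h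
end

section
/- Let L be a finite-dimensional metabelian Lie algebra of dimension n over a field F with dim L² = k, and suppose that L splits over L², i.e. L = L² ∔ B (vector space direct sum) for some abelian subalgebra B of L. Then β(L) ≥ n − ⌊k²/4⌋ − 1. -/
open Module

/-- `α(L)`: the maximal dimension of an abelian Lie subalgebra of `L`. -/
noncomputable def alphaInv (F L : Type*) [Field F] [LieRing L] [LieAlgebra F L] : ℕ :=
  sSup {d | ∃ A : LieSubalgebra F L, IsLieAbelian A ∧ Module.finrank F A = d}

/-- `β(L)`: the maximal dimension of an abelian Lie ideal of `L`. -/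
noncomputable def betaInv (F L : Type*) [Field F] [LieRing L] [LieAlgebra F L] : ℕ :=
  sSup {d | ∃ I : LieIdeal F L, IsLieAbelian I ∧ Module.finrank F I = d}

namespace Module.End

variable {K V : Type*} [Field K] [AddCommGroup V] [Module K V] [FiniteDimensional K V]

/-- A commuting family of endomorphisms over an algebraically closed field has a common
eigenvector. -/
theorem exists_common_eigenvector_of_commute [IsAlgClosed K] [Nontrivial V] (s : Set (End K V))
    (hs : ∀ A ∈ s, ∀ B ∈ s, A * B = B * A) :
    ∃ v : V, v ≠ 0 ∧ ∀ T ∈ s, ∃ c : K, T v = c • v := by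
  suffices H : ∀ (m : ℕ) (U : Submodule K V), finrank K U = m → U ≠ ⊥ →
      (∀ T ∈ s, ∀ x ∈ U, T x ∈ U) → ∃ v : V, v ≠ 0 ∧ ∀ T ∈ s, ∃ c : K, T v = c • v from
    H _ ⊤ rfl top_ne_bot fun _ _ _ _ => Submodule.mem_top
  intro m
  induction m using Nat.strong_induction_on with
  | _ m ih =>
    intro U hU hbot hinv
    by_cases hscalar : ∀ T ∈ s, ∃ c : K, ∀ x ∈ U, T x = c • x
    · obtain ⟨v, hv, hv0⟩ := U.ne_bot_iff.mp hbot
      exact ⟨v, hv0, fun T hT => (hscalar T hT).imp fun c hc => hc v hv⟩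
    · push Not at hscalar
      obtain ⟨T, hT, hTU⟩ := hscalar
      have : Nontrivial U := U.nontrivial_iff_ne_bot.mpr hbot
      obtain ⟨μ, hμ⟩ := Module.End.exists_eigenvalue (T.restrict (hinv T hT))
      obtain ⟨u, hu⟩ := hμ.exists_hasEigenvector
      have hTu : T u = μ • (u : V) := congrArg Subtype.val hu.apply_eq_smul
      have hu0 : (u : V) ≠ 0 := fun h => hu.2 (Subtype.ext h)
      refine ih (finrank K (U ⊓ T.eigenspace μ : Submodule K V)) ?_ _ rfl ?_ ?_
      · rw [← hU]
        refine Submodule.finrank_lt_finrank_of_lt (lt_of_le_of_ne inf_le_left fun h => ?_)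
        obtain ⟨x, hx, hne⟩ := hTU μ
        exact hne (Module.End.mem_eigenspace_iff.mp (inf_eq_left.mp h hx))
      · exact (Submodule.ne_bot_iff _).mpr
          ⟨u, ⟨u.2, Module.End.mem_eigenspace_iff.mpr hTu⟩, hu0⟩
      · rintro A hA x ⟨hx, hxT⟩
        refine ⟨hinv A hA x hx, Module.End.mem_eigenspace_iff.mpr ?_⟩
        have h := LinearMap.congr_fun (hs T hT A hA) x
        simp only [Module.End.mul_apply] at h
        rw [h, Module.End.mem_eigenspace_iff.mp hxT, map_smul]

/-- If compressing a commuting space `S` of endomorphisms of `V` to `W` is multiplicative,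
then `finrank K S` is at most a bound for commuting spaces on `W` plus the dimension of the part
of `S` that compresses to zero. -/
theorem finrank_le_add_of_compression {W : Type*} [AddCommGroup W] [Module K W]
    (S P : Submodule K (End K V)) (hS : ∀ A ∈ S, ∀ B ∈ S, A * B = B * A)
    (i : W →ₗ[K] V) (p : V →ₗ[K] W)
    (hmul : ∀ A ∈ S, ∀ B ∈ S, ∀ w, p (A (i (p (B (i w))))) = p (A (B (i w))))
    (hP : ∀ T ∈ S, (∀ w, p (T (i w)) = 0) → T ∈ P) (N : ℕ)
    (hN : ∀ S' : Submodule K (End K W), (∀ A ∈ S', ∀ B ∈ S', A * B = B * A) →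
      finrank K S' ≤ N) :
    finrank K S ≤ N + finrank K (S ⊓ P : Submodule K (End K V)) := by
  let c : End K V →ₗ[K] End K W :=
    { toFun := fun T => p ∘ₗ T ∘ₗ i
      map_add' := fun _ _ => by ext; simp
      map_smul' := fun _ _ => by ext; simp }
  have hc : ∀ T w, c T w = p (T (i w)) := fun _ _ => rfl
  have hker : finrank K (LinearMap.ker (c.domRestrict S)) ≤
      finrank K (S ⊓ P : Submodule K (End K V)) := by
    rw [← Submodule.finrank_map_subtype_eq]
    refine Submodule.finrank_mono ?_
    rintro _ ⟨T, hT, rfl⟩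
    exact ⟨T.2, hP _ T.2 fun w => LinearMap.congr_fun hT w⟩
  have hrange := hN (LinearMap.range (c.domRestrict S)) <| by
    rintro _ ⟨⟨A, hA⟩, rfl⟩ _ ⟨⟨B, hB⟩, rfl⟩
    ext w
    simp only [LinearMap.domRestrict_apply, Module.End.mul_apply, hc]
    rw [hmul A hA B hB, hmul B hB A hA, ← Module.End.mul_apply, hS A hA B hB, Module.End.mul_apply]
  rw [← LinearMap.finrank_range_add_finrank_ker (c.domRestrict S)]
  exact add_le_add hrange hker

/-- In a commuting space of endomorphisms, either those with image in the line of a common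
eigenvector `v` or those vanishing on the kernel of a common eigenfunctional `f` form a subspace
of dimension at most half of `finrank K V`. -/
theorem finrank_inf_le_half (S P Q : Submodule K (End K V))
    (hS : ∀ A ∈ S, ∀ B ∈ S, A * B = B * A) (hV : 2 ≤ finrank K V) {v : V} (hv : v ≠ 0)
    {f : Dual K V} (hf : f ≠ 0) (hSv : ∀ T ∈ S, ∃ c : K, T v = c • v)
    (hP : ∀ T ∈ P, ∀ x, T x ∈ Submodule.span K {v})
    (hQ : ∀ T ∈ Q, ∀ x, f x = 0 → T x = 0) :
    finrank K (S ⊓ P : Submodule K (End K V)) ≤ finrank K V / 2 ∨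
      finrank K (S ⊓ Q : Submodule K (End K V)) ≤ finrank K V / 2 := by
  obtain ⟨g, hg⟩ : ∃ g : Dual K V, g v = 1 := by
    obtain ⟨g, hg⟩ := not_forall.mp (mt (Module.forall_dual_apply_eq_zero_iff K v).mp hv)
    exact ⟨(g v)⁻¹ • g, by simp [hg]⟩
  obtain ⟨u, hu⟩ : ∃ u : V, f u = 1 := by
    obtain ⟨u, hu⟩ := not_forall.mp (mt LinearMap.ext hf)
    rw [LinearMap.zero_apply] at hu
    exact ⟨(f u)⁻¹ • u, by simp [hu]⟩
  have hPv : ∀ T ∈ P, ∀ x, T x = g (T x) • v := by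
    intro T hT x
    obtain ⟨c, hc⟩ := Submodule.mem_span_singleton.mp (hP T hT x)
    simp [← hc, hg]
  have hQu : ∀ T ∈ Q, ∀ x, T x = f x • T u := by
    intro T hT x
    have h := hQ T hT (x - f x • u) (by simp [hu])
    rwa [map_sub, map_smul, sub_eq_zero] at h
  let φ : (S ⊓ P : Submodule K (End K V)) →ₗ[K] Dual K V :=
    (LinearMap.compRight K g).domRestrict (S ⊓ P)
  let ψ : (S ⊓ Q : Submodule K (End K V)) →ₗ[K] V := (LinearMap.applyₗ u).domRestrict (S ⊓ Q)
  have hφapp : ∀ T x, φ T x = g (T.1 x) := fun _ _ => rfl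
  have hψapp : ∀ T, ψ T = T.1 u := fun _ => rfl
  have hφ : Function.Injective φ := by
    refine (injective_iff_map_eq_zero φ).mpr fun T hT => Subtype.ext (LinearMap.ext fun x => ?_)
    rw [hPv T.1 T.2.2 x, ← hφapp, hT]
    simp
  have hψ : Function.Injective ψ := by
    refine (injective_iff_map_eq_zero ψ).mpr fun T hT => Subtype.ext (LinearMap.ext fun x => ?_)
    rw [hQu T.1 T.2.2 x, ← hψapp, hT]
    simp
  rw [← LinearMap.finrank_range_of_inj hφ, ← LinearMap.finrank_range_of_inj hψ]
  by_cases hfv : f v = 0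
  · have hle : LinearMap.range φ ≤ (LinearMap.range ψ).dualAnnihilator := by
      rintro _ ⟨A, rfl⟩
      rw [Submodule.mem_dualAnnihilator]
      rintro _ ⟨B, rfl⟩
      have hAB := LinearMap.congr_fun (hS A.1 A.2.1 B.1 B.2.1) u
      simp only [Module.End.mul_apply] at hAB
      rw [hφapp, hψapp, hAB, hPv A.1 A.2.2 u, map_smul, hQ B.1 B.2.2 v hfv, smul_zero, map_zero]
    have h1 := Submodule.finrank_mono hle
    have h2 := Subspace.finrank_add_finrank_dualAnnihilator_eq (LinearMap.range ψ)
    omega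
  · right
    have hle : LinearMap.range ψ ≤ Submodule.span K {v} := by
      rintro _ ⟨B, rfl⟩
      obtain ⟨c, hc⟩ := hSv B.1 B.2.1
      refine Submodule.mem_span_singleton.mpr ⟨(f v)⁻¹ * c, ?_⟩
      rw [mul_smul, ← hc, hQu B.1 B.2.2 v, smul_smul, inv_mul_cancel₀ hfv, one_smul, hψapp]
    have h1 := Submodule.finrank_mono hle
    rw [finrank_span_singleton hv] at h1
    omega

theorem finrank_le_of_commute_of_isAlgClosed {K : Type*} [Field K] [IsAlgClosed K] (n : ℕ) :
    ∀ {V : Type*} [AddCommGroup V] [Module K V] [FiniteDimensional K V], finrank K V = n →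
      ∀ S : Submodule K (End K V), (∀ A ∈ S, ∀ B ∈ S, A * B = B * A) →
        finrank K S ≤ n ^ 2 / 4 + 1 := by
  induction n with
  | zero =>
    intro V _ _ _ hn S _
    have := Submodule.finrank_le S
    rw [Module.finrank_linearMap, hn] at this
    omega
  | succ m ih =>
    intro V _ _ _ hn S hS
    rcases Nat.eq_zero_or_pos m with rfl | hm
    · have := Submodule.finrank_le S
      rw [Module.finrank_linearMap, hn] at this
      omega
    have : Nontrivial V := Module.nontrivial_of_finrank_pos (R := K) (by omega)
    obtain ⟨v, hv, hSv⟩ := exists_common_eigenvector_of_commute (S : Set (End K V)) hS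
    obtain ⟨f, hf, hSf⟩ : ∃ f : Dual K V, f ≠ 0 ∧ ∀ T ∈ S, ∃ c : K, ∀ x, f (T x) = c * f x := by
      obtain ⟨f, hf, h⟩ := exists_common_eigenvector_of_commute
        ((fun T : End K V => (T.dualMap : End K (Dual K V))) '' (S : Set (End K V))) <| by
          rintro _ ⟨A, hA, rfl⟩ _ ⟨B, hB, rfl⟩
          ext h x
          have hAB := LinearMap.congr_fun (hS A hA B hB) x
          simp only [Module.End.mul_apply] at hAB
          simp [hAB]
      refine ⟨f, hf, fun T hT => ?_⟩
      obtain ⟨c, hc⟩ := h _ ⟨T, hT, rfl⟩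
      exact ⟨c, fun x => LinearMap.congr_fun hc x⟩
    let P : Submodule K (End K V) :=
      { carrier := {T | ∀ x, T x ∈ Submodule.span K {v}}
        add_mem' := fun hA hB x => add_mem (hA x) (hB x)
        zero_mem' := fun _ => zero_mem _
        smul_mem' := fun c _ hA x => Submodule.smul_mem _ c (hA x) }
    let Q : Submodule K (End K V) :=
      { carrier := {T | ∀ x, f x = 0 → T x = 0}
        add_mem' := fun hA hB x hx => by simp [hA x hx, hB x hx]
        zero_mem' := fun _ _ => rfl
        smul_mem' := fun c _ hA x hx => by simp [hA x hx] }
    obtain ⟨W, hW⟩ := Submodule.exists_isCompl (Submodule.span K {v})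
    have hWdim : finrank K W = m := by
      have := Submodule.finrank_add_eq_of_isCompl hW
      rw [finrank_span_singleton hv, hn] at this
      omega
    obtain ⟨C, hC⟩ := Submodule.exists_isCompl (LinearMap.ker f)
    have hkerdim : finrank K (LinearMap.ker f) = m := by
      have := Module.Dual.finrank_ker_add_one_of_ne_zero hf
      omega
    have hSP : finrank K S ≤ (m ^ 2 / 4 + 1) + finrank K (S ⊓ P : Submodule K (End K V)) := by
      have hpz : ∀ y, W.projectionOnto _ hW.symm y = 0 ↔ y ∈ Submodule.span K {v} := fun y =>
        Submodule.projectionOnto_apply_eq_zero_iff hW.symm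
      have hinv : ∀ T ∈ S, ∀ y ∈ Submodule.span K {v}, T y ∈ Submodule.span K {v} := by
        intro T hT y hy
        obtain ⟨a, rfl⟩ := Submodule.mem_span_singleton.mp hy
        obtain ⟨c, hc⟩ := hSv T hT
        rw [map_smul, hc]
        exact Submodule.smul_mem _ _ (Submodule.smul_mem _ _ (Submodule.mem_span_singleton_self v))
      have hdiff : ∀ y, y - (W.projectionOnto _ hW.symm y : V) ∈ Submodule.span K {v} := fun y =>
        Submodule.sub_projection_mem hW.symm y
      refine finrank_le_add_of_compression S P hS W.subtype (W.projectionOnto _ hW.symm) ?_ ?_ _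
        (ih hWdim)
      · intro A hA B _ w
        refine (sub_eq_zero.mp ?_).symm
        rw [← map_sub, ← map_sub]
        exact (hpz _).mpr (hinv A hA _ (hdiff _))
      · intro T hT h x
        have hx := add_mem (hinv T hT _ (hdiff x)) ((hpz _).mp (h (W.projectionOnto _ hW.symm x)))
        rwa [Submodule.subtype_apply, ← map_add, sub_add_cancel] at hx
    have hSQ : finrank K S ≤ (m ^ 2 / 4 + 1) + finrank K (S ⊓ Q : Submodule K (End K V)) := by
      have hinv : ∀ T ∈ S, ∀ y ∈ LinearMap.ker f, T y ∈ LinearMap.ker f := by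
        intro T hT y hy
        obtain ⟨c, hc⟩ := hSf T hT
        rw [LinearMap.mem_ker] at hy ⊢
        rw [hc, hy, mul_zero]
      have hp : ∀ y ∈ LinearMap.ker f, ((LinearMap.ker f).projectionOnto _ hC y : V) = y :=
        fun y hy => congrArg Subtype.val (Submodule.projectionOnto_apply_left hC ⟨y, hy⟩)
      refine finrank_le_add_of_compression S Q hS (LinearMap.ker f).subtype
        ((LinearMap.ker f).projectionOnto _ hC) ?_ ?_ _ (ih hkerdim)
      · intro A _ B hB w
        rw [Submodule.subtype_apply, Submodule.subtype_apply, hp _ (hinv B hB _ w.2)]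
      · intro T hT h x hx
        have := congrArg Subtype.val (h ⟨x, hx⟩)
        rwa [Submodule.subtype_apply, hp _ (hinv T hT x hx)] at this
    have hnat : m ^ 2 / 4 + (m + 1) / 2 = (m + 1) ^ 2 / 4 := by
      obtain ⟨j, rfl | rfl⟩ := m.even_or_odd'
      · rw [show (2 * j) ^ 2 = j ^ 2 * 4 by ring,
          show (2 * j + 1) ^ 2 = (j ^ 2 + j) * 4 + 1 by ring]
        omega
      · rw [show (2 * j + 1) ^ 2 = (j ^ 2 + j) * 4 + 1 by ring,
          show (2 * j + 1 + 1) ^ 2 = (j ^ 2 + 2 * j + 1) * 4 by ring]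
        omega
    rcases finrank_inf_le_half S P Q hS (by omega) hv hf hSv (fun _ h => h) (fun _ h => h)
      with h | h <;> rw [hn] at h <;> omega

/-- A family of matrices linearly independent over a field stays so over any extension field. -/
theorem _root_.LinearIndependent.matrix_map_algebraMap {F E ι m n : Type*} [Field F] [Field E]
    [Algebra F E] [Fintype ι] {M : ι → Matrix m n F} (hM : LinearIndependent F M) :
    LinearIndependent E fun j => (M j).map (algebraMap F E) := by
  rw [Fintype.linearIndependent_iff] at hM ⊢
  intro c hc j
  refine (Module.forall_dual_apply_eq_zero_iff F (c j)).mp fun l => ?_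
  refine hM (fun j => l (c j)) ?_ j
  ext a b
  have h := congrArg l (congrFun (congrFun hc a) b)
  simp only [Matrix.sum_apply, Matrix.smul_apply, Matrix.map_apply, smul_eq_mul, map_sum,
    Matrix.zero_apply, map_zero] at h ⊢
  rw [← h]
  refine Finset.sum_congr rfl fun t _ => ?_
  rw [mul_comm (c t), ← Algebra.smul_def, map_smul, smul_eq_mul, mul_comm]

/-- Linearly independent commuting endomorphisms of an `n`-dimensional vector space over an
algebraically closed field number at most `⌊n² / 4⌋ + 1`. -/
theorem card_le_of_commute_of_isAlgClosed [IsAlgClosed K] {ι : Type*} [Fintype ι]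
    {T : ι → End K V} (hT : LinearIndependent K T) (hcomm : ∀ j l, T j * T l = T l * T j) :
    Fintype.card ι ≤ finrank K V ^ 2 / 4 + 1 := by
  rw [← finrank_span_eq_card hT]
  refine finrank_le_of_commute_of_isAlgClosed _ rfl _ fun A hA B hB => ?_
  induction hA, hB using Submodule.span_induction₂ with
  | mem_mem x y hx hy =>
    obtain ⟨j, rfl⟩ := hx
    obtain ⟨l, rfl⟩ := hy
    exact hcomm j l
  | zero_left => simp
  | zero_right => simp
  | add_left x y z _ _ _ h1 h2 => rw [add_mul, mul_add, h1, h2]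
  | add_right x y z _ _ _ h1 h2 => rw [add_mul, mul_add, h1, h2]
  | smul_left r x y _ _ h => rw [smul_mul_assoc, mul_smul_comm, h]
  | smul_right r x y _ _ h => rw [smul_mul_assoc, mul_smul_comm, h]

/-- Linearly independent commuting `n × n` matrices over a field number at most
`⌊n² / 4⌋ + 1`. -/
theorem _root_.Matrix.card_le_of_commute {F ι n : Type*} [Field F] [Fintype ι] [Fintype n]
    [DecidableEq n] {M : ι → Matrix n n F} (hM : LinearIndependent F M)
    (hcomm : ∀ j l, M j * M l = M l * M j) :
    Fintype.card ι ≤ Fintype.card n ^ 2 / 4 + 1 := by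
  have hT := hM.matrix_map_algebraMap (E := AlgebraicClosure F)
  have h := card_le_of_commute_of_isAlgClosed
    (hT.map' Matrix.toLin'.toLinearMap (LinearEquiv.ker _)) fun j l => by
      change Matrix.toLin' _ * Matrix.toLin' _ = Matrix.toLin' _ * Matrix.toLin' _
      rw [Module.End.mul_eq_comp, Module.End.mul_eq_comp, ← Matrix.toLin'_mul,
        ← Matrix.toLin'_mul, ← Matrix.map_mul, ← Matrix.map_mul, hcomm]
  rwa [Module.finrank_fintype_fun_eq_card] at h

/-- **Schur's theorem**: a space of commuting endomorphisms of an `n`-dimensional vector space has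
dimension at most `⌊n² / 4⌋ + 1`. -/
theorem finrank_le_of_commute (S : Submodule K (End K V))
    (hS : ∀ A ∈ S, ∀ B ∈ S, A * B = B * A) : finrank K S ≤ finrank K V ^ 2 / 4 + 1 := by
  let b := finBasis K V
  let e := finBasis K S
  have hM : LinearIndependent K fun j => LinearMap.toMatrix b b (e j).1 :=
    (e.linearIndependent.map' S.subtype S.ker_subtype).map'
      (LinearMap.toMatrix b b).toLinearMap (LinearEquiv.ker _)
  have h := Matrix.card_le_of_commute hM fun j l => by
    rw [← LinearMap.toMatrix_mul, ← LinearMap.toMatrix_mul, hS _ (e j).2 _ (e l).2]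
  rwa [Fintype.card_fin, Fintype.card_fin] at h

end Module.End

/-- If `L` is a finite-dimensional metabelian Lie algebra of dimension `n`
with `dim L² = k`, and `L` splits over `L²` (i.e. `L = L² ∔ B` for some abelian subalgebra
`B`), then `β(L) ≥ n − ⌊k²/4⌋ − 1`. -/
theorem betaInv_ge_of_metabelian_split (F L : Type*) [Field F] [LieRing L]
    [LieAlgebra F L] [FiniteDimensional F L]
    (hmeta : IsLieAbelian (LieAlgebra.derivedSeries F L 1))
    (n k : ℕ) (hn : Module.finrank F L = n)
    (hk : Module.finrank F (LieAlgebra.derivedSeries F L 1) = k)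
    (hsplit : ∃ B : LieSubalgebra F L, IsLieAbelian B ∧
      IsCompl (LieAlgebra.derivedSeries F L 1).toSubmodule B.toSubmodule) :
    n - k ^ 2 / 4 - 1 ≤ betaInv F L := by
  let D := LieAlgebra.derivedSeries F L 1
  let ρ : L →ₗ[F] End F D := (LieModule.toEnd F L D : L →ₗ[F] End F D)
  have hlie : ∀ x y : L, ⁅x, y⁆ ∈ D := by
    intro x y
    simp only [D, LieAlgebra.derivedSeriesOfIdeal_succ,
      LieAlgebra.derivedSeriesOfIdeal_zero]
    exact LieSubmodule.lie_mem_lie (LieSubmodule.mem_top x) (LieSubmodule.mem_top y)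
  have hDD : ∀ x ∈ D, ∀ y ∈ D, ⁅x, y⁆ = 0 := fun x hx y hy =>
    congrArg Subtype.val (hmeta.trivial ⟨x, hx⟩ ⟨y, hy⟩)
  have hbound : finrank F (LinearMap.range ρ) ≤ k ^ 2 / 4 + 1 := by
    rw [← hk]
    refine End.finrank_le_of_commute _ ?_
    rintro _ ⟨x, rfl⟩ _ ⟨y, rfl⟩
    ext d
    have h : ⁅⁅x, y⁆, (d : L)⁆ = 0 := hDD _ (hlie x y) _ d.2
    rw [lie_lie, sub_eq_zero] at h
    exact h
  have hZ : IsLieAbelian (LieModule.ker F L D) := by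
    obtain ⟨B, hB, hc⟩ := hsplit
    have hZD : ∀ x ∈ LieModule.ker F L D, ∀ d ∈ D, ⁅x, d⁆ = 0 := fun x hx d hd =>
      congrArg Subtype.val ((LieModule.mem_ker F L D x).mp hx ⟨d, hd⟩)
    have hdec : ∀ x : L, ∃ d ∈ D, ∃ b ∈ B, d + b = x := fun x =>
      Submodule.mem_sup.mp (hc.sup_eq_top ▸ Submodule.mem_top : x ∈ D.toSubmodule ⊔ B.toSubmodule)
    refine ⟨fun ⟨x, hx⟩ ⟨y, hy⟩ => Subtype.ext ?_⟩
    obtain ⟨d, hd, b, hb, rfl⟩ := hdec x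
    obtain ⟨d', hd', b', hb', rfl⟩ := hdec y
    have hbb : ⁅b, b'⁆ = 0 := congrArg Subtype.val (hB.trivial ⟨b, hb⟩ ⟨b', hb'⟩)
    have h1 : ⁅d + b, d'⁆ = 0 := hZD _ hx d' hd'
    have h2 : ⁅d' + b', d⁆ = 0 := hZD _ hy d hd
    have h3 : ⁅d, b'⁆ = 0 := by
      rw [add_lie, hDD d' hd' d hd, zero_add] at h2
      rw [← lie_skew, h2, neg_zero]
    change ⁅d + b, d' + b'⁆ = 0
    rw [lie_add, h1, add_lie, h3, hbb, add_zero, add_zero]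
  have hle : finrank F (LieModule.ker F L D) ≤ betaInv F L :=
    le_csSup ⟨finrank F L, by rintro _ ⟨I, _, rfl⟩; exact Submodule.finrank_le I.toSubmodule⟩
      ⟨_, hZ, rfl⟩
  have hrank := LinearMap.finrank_range_add_finrank_ker ρ
  have hker : finrank F (LinearMap.ker ρ) = finrank F (LieModule.ker F L D) := rfl
  omega
end

section
/- Let L be a finite-dimensional supersolvable Lie algebra over a field F with a maximal abelian ideal A of dimension k. Then dim L ≤ k(k+3)/2 and L has derived length at most k + 1, i.e. L^(k+1) = 0 where L^(0) = L and L^(i+1) = [L^(i), L^(i)]. -/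
open Module

/-- A finite-dimensional Lie algebra `L` of dimension `n` is supersolvable if there is a chain
`0 = L₀ ⊆ L₁ ⊆ … ⊆ Lₙ = L` of ideals of `L` with `dim Lᵢ = i`. -/
def IsSupersolvable (F L : Type*) [Field F] [LieRing L] [LieAlgebra F L] : Prop :=
  ∃ C : ℕ → LieIdeal F L, Monotone C ∧ C 0 = ⊥ ∧ C (Module.finrank F L) = ⊤ ∧
    ∀ i ≤ Module.finrank F L, Module.finrank F (C i) = i

/-- `C'` contains `C` and is spanned by `C` together with at most one further vector. -/
def LieIdeal.IsOneStep {F L : Type*} [Field F] [LieRing L] [LieAlgebra F L]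
    (C C' : LieIdeal F L) : Prop :=
  C ≤ C' ∧ ∃ x ∈ C', ∀ y ∈ C', ∃ c : F, y - c • x ∈ C

section

variable {F L : Type*} [Field F] [LieRing L] [LieAlgebra F L]

namespace LieIdeal

lemma mem_ker_iff {B : LieIdeal F L} {z : L} :
    z ∈ LieModule.ker F L B ↔ ∀ b ∈ B, ⁅z, b⁆ = 0 := by
  rw [LieModule.mem_ker]
  refine ⟨fun h b hb => congrArg Subtype.val (h ⟨b, hb⟩), fun h b => Subtype.ext (h b b.2)⟩

lemma isOneStep_of_finrank [FiniteDimensional F L] {C C' : LieIdeal F L} (h : C ≤ C')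
    (hd : finrank F C' = finrank F C + 1) : IsOneStep C C' := by
  refine ⟨h, ?_⟩
  obtain ⟨x, hx, hxC⟩ : ∃ x ∈ C', x ∉ C := by
    by_contra! hle
    have : C' = C := le_antisymm hle h
    subst this
    omega
  refine ⟨x, hx, fun y hy => ?_⟩
  have hle : C.toSubmodule ⊔ Submodule.span F {x} ≤ C'.toSubmodule :=
    sup_le h ((Submodule.span_singleton_le_iff_mem _ _).2 hx)
  have heq := Submodule.eq_of_le_of_finrank_eq hle
    ((Submodule.finrank_sup_span_singleton (p := C.toSubmodule) hxC).trans hd.symm)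
  have hy' : y ∈ C.toSubmodule ⊔ Submodule.span F {x} := heq ▸ hy
  obtain ⟨z, hz, w, hw, rfl⟩ := Submodule.mem_sup.1 hy'
  obtain ⟨c, rfl⟩ := Submodule.mem_span_singleton.1 hw
  exact ⟨c, by simpa using hz⟩

lemma IsOneStep.inf {C C' : LieIdeal F L} (h : IsOneStep C C') (A : LieIdeal F L) :
    IsOneStep (A ⊓ C) (A ⊓ C') := by
  obtain ⟨hle, x, hx, hspan⟩ := h
  refine ⟨inf_le_inf_left A hle, ?_⟩
  by_cases hAC : A ⊓ C' ≤ C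
  · exact ⟨0, zero_mem _, fun y hy => ⟨0, by simpa using ⟨hy.1, hAC hy⟩⟩⟩
  · obtain ⟨y₀, hy₀, hy₀C⟩ := SetLike.not_le_iff_exists.1 hAC
    refine ⟨y₀, hy₀, fun y hy => ?_⟩
    obtain ⟨c₀, hc₀⟩ := hspan y₀ hy₀.2
    obtain ⟨c, hc⟩ := hspan y hy.2
    have hne : c₀ ≠ 0 := by
      rintro rfl
      exact hy₀C (by simpa using hc₀)
    refine ⟨c / c₀, sub_mem hy.1 (A.smul_mem _ hy₀.1), ?_⟩
    have : y - (c / c₀) • y₀ = (y - c • x) - (c / c₀) • (y₀ - c₀ • x) := by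
      rw [smul_sub, smul_smul, div_mul_cancel₀ _ hne]
      abel
    rw [this]
    exact sub_mem hc (C.smul_mem _ hc₀)

lemma IsOneStep.eq_or_finrank [FiniteDimensional F L] {B B' : LieIdeal F L}
    (h : IsOneStep B B') : B' = B ∨ finrank F B' = finrank F B + 1 := by
  obtain ⟨hle, x, hx, hspan⟩ := h
  by_cases hxB : x ∈ B
  · refine Or.inl (le_antisymm (fun y hy => ?_) hle)
    obtain ⟨c, hc⟩ := hspan y hy
    simpa using add_mem hc (B.smul_mem c hxB)
  · right
    refine Eq.trans ?_ (Submodule.finrank_sup_span_singleton (p := B.toSubmodule) hxB)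
    have : B'.toSubmodule = B.toSubmodule ⊔ Submodule.span F {x} := by
      refine le_antisymm (fun y hy => ?_)
        (sup_le hle ((Submodule.span_singleton_le_iff_mem _ _).2 hx))
      obtain ⟨c, hc⟩ := hspan y hy
      exact Submodule.mem_sup.2 ⟨_, hc, c • x,
        Submodule.smul_mem _ _ (Submodule.mem_span_singleton_self x), by simp⟩
    exact congrArg (fun S : Submodule F L => finrank F S) this

lemma IsOneStep.finrank_ker_le [FiniteDimensional F L] {B B' : LieIdeal F L}
    (h : IsOneStep B B') :
    finrank F (LieModule.ker F L B) ≤ finrank F (LieModule.ker F L B') + finrank F B' := by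
  obtain ⟨hle, x, hx, hspan⟩ := h
  let φ : (LieModule.ker F L B).toSubmodule →ₗ[F] B'.toSubmodule :=
    { toFun := fun z => ⟨⁅(z : L), x⁆, lie_mem_right F L B' _ _ hx⟩
      map_add' := fun a b => Subtype.ext (add_lie _ _ _)
      map_smul' := fun c a => Subtype.ext (smul_lie _ _ _) }
  have hker : φ.ker.map (LieModule.ker F L B).toSubmodule.subtype ≤
      (LieModule.ker F L B').toSubmodule := by
    rintro _ ⟨z, hz, rfl⟩
    refine mem_ker_iff.2 fun y hy => ?_
    have hzx : ⁅(z : L), x⁆ = 0 := congrArg Subtype.val (LinearMap.mem_ker.1 hz)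
    obtain ⟨c, hc⟩ := hspan y hy
    have hzc := mem_ker_iff.1 z.2 _ hc
    rwa [lie_sub, lie_smul, hzx, smul_zero, sub_zero] at hzc
  have h₁ := Submodule.finrank_mono hker
  rw [Submodule.finrank_map_subtype_eq] at h₁
  have h₂ := φ.range.finrank_le
  have h₃ := φ.finrank_range_add_finrank_ker
  change finrank F (LieModule.ker F L B).toSubmodule ≤
    finrank F (LieModule.ker F L B').toSubmodule + finrank F B'.toSubmodule
  omega

lemma bracket_le_of_forall_mem {I J : LieIdeal F L} {S : Submodule F L}
    (h : ∀ u ∈ I, ∀ v ∈ J, ⁅u, v⁆ ∈ S) : (⁅I, J⁆ : LieIdeal F L).toSubmodule ≤ S := by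
  rw [LieSubmodule.lieIdeal_oper_eq_linear_span', Submodule.span_le]
  rintro _ ⟨u, hu, v, hv, rfl⟩
  exact h u hu v hv

lemma IsOneStep.derivedSeries_one_lie_mem {B B' : LieIdeal F L} (h : IsOneStep B B')
    {w y : L} (hw : w ∈ LieAlgebra.derivedSeries F L 1) (hy : y ∈ B') : ⁅w, y⁆ ∈ B := by
  obtain ⟨hle, x, hx, hspan⟩ := h
  let S : Submodule F L :=
    { carrier := {w | ⁅w, x⁆ ∈ B}
      add_mem' := fun {a b} ha hb => by
        rw [Set.mem_ofPred_eq, add_lie]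
        exact add_mem ha hb
      zero_mem' := by simp
      smul_mem' := fun c a ha => by
        rw [Set.mem_ofPred_eq, smul_lie]
        exact B.smul_mem c ha }
  have hS : (⁅(⊤ : LieIdeal F L), (⊤ : LieIdeal F L)⁆ : LieIdeal F L).toSubmodule ≤ S := by
    refine bracket_le_of_forall_mem fun u _ v _ => ?_
    change ⁅⁅u, v⁆, x⁆ ∈ B
    obtain ⟨a, ha⟩ := hspan ⁅u, x⁆ (lie_mem_right F L B' _ _ hx)
    obtain ⟨b, hb⟩ := hspan ⁅v, x⁆ (lie_mem_right F L B' _ _ hx)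
    have : ⁅⁅u, v⁆, x⁆ = (⁅u, ⁅v, x⁆ - b • x⁆ + b • (⁅u, x⁆ - a • x)) -
        (⁅v, ⁅u, x⁆ - a • x⁆ + a • (⁅v, x⁆ - b • x)) := by
      simp only [lie_lie, lie_sub, lie_smul, smul_sub, smul_smul, mul_comm a b]
      abel
    rw [this]
    exact sub_mem (add_mem (lie_mem_right F L B _ _ hb) (B.smul_mem _ ha))
      (add_mem (lie_mem_right F L B _ _ ha) (B.smul_mem _ hb))
  have hwx : ⁅w, x⁆ ∈ B := hS hw
  obtain ⟨c, hc⟩ := hspan y hy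
  have := add_mem (lie_mem_right F L B w _ hc) (B.smul_mem c hwx)
  rwa [lie_sub, lie_smul, sub_add_cancel] at this

lemma IsOneStep.derivedSeries_succ_le_ker [FiniteDimensional F L] {B B' : LieIdeal F L}
    (h : IsOneStep B B')
    (hB : LieAlgebra.derivedSeries F L (finrank F B) ≤ LieModule.ker F L B) :
    LieAlgebra.derivedSeries F L (finrank F B + 1) ≤ LieModule.ker F L B' := by
  rcases Nat.eq_zero_or_pos (finrank F B) with h0 | hpos
  · have hbot : B.toSubmodule = ⊥ := Submodule.finrank_eq_zero.1 h0
    rw [h0]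
    intro w hw
    refine mem_ker_iff.2 fun y hy => ?_
    have hwy : ⁅w, y⁆ ∈ B.toSubmodule := h.derivedSeries_one_lie_mem hw hy
    simpa [hbot] using hwy
  · have hmem : ∀ u ∈ LieAlgebra.derivedSeries F L (finrank F B), ∀ y ∈ B', ⁅u, y⁆ ∈ B :=
      fun u hu y hy => h.derivedSeries_one_lie_mem
        (LieAlgebra.derivedSeriesOfIdeal_antitone ⊤ hpos hu) hy
    rw [LieAlgebra.derivedSeries_def, LieAlgebra.derivedSeriesOfIdeal_succ]
    refine bracket_le_of_forall_mem (S := (LieModule.ker F L B').toSubmodule)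
      fun u hu v hv => mem_ker_iff.2 fun y hy => ?_
    rw [lie_lie, mem_ker_iff.1 (hB hu) _ (hmem v hv y hy),
      mem_ker_iff.1 (hB hv) _ (hmem u hu y hy), sub_zero]

/-- If `L` has a full flag of ideals, then a maximal abelian ideal contains its own centralizer. -/
lemma ker_le_of_maximal {A : LieIdeal F L} (hA : IsLieAbelian A)
    (hAmax : ∀ B : LieIdeal F L, IsLieAbelian B → A ≤ B → B = A)
    {C : ℕ → LieIdeal F L} {n : ℕ} (h0 : C 0 = ⊥) (hn : C n = ⊤)
    (hC : ∀ i < n, IsOneStep (C i) (C (i + 1))) : LieModule.ker F L A ≤ A := by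
  set Z := LieModule.ker F L A
  have hAZ : A ≤ Z := (isLieAbelian_iff F L).1 hA
  suffices h : ∀ i ≤ n, Z ⊓ C i ≤ A by simpa [hn] using h n le_rfl
  intro i
  induction i with
  | zero => simp [h0]
  | succ i ih =>
    intro hi
    obtain ⟨-, x, hx, hspan⟩ := (hC i hi).inf Z
    have hdec : ∀ b ∈ A ⊔ (Z ⊓ C (i + 1)), ∃ c : F, b - c • x ∈ A := by
      intro b hb
      obtain ⟨a, ha, z, hz, rfl⟩ := (LieSubmodule.mem_sup _ _ _).1 hb
      obtain ⟨c, hc⟩ := hspan z hz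
      exact ⟨c, by simpa [add_sub_assoc] using add_mem ha (ih (by omega) hc)⟩
    have hxA : ∀ a ∈ A, ⁅x, a⁆ = 0 := mem_ker_iff.1 hx.1
    have hAA : ∀ a ∈ A, ∀ b ∈ A, ⁅a, b⁆ = 0 := fun a ha => mem_ker_iff.1 (hAZ ha)
    rw [← hAmax (A ⊔ (Z ⊓ C (i + 1))) ?_ le_sup_left]
    · exact le_sup_right
    refine (isLieAbelian_iff F L).2 fun a ha => mem_ker_iff.2 fun b hb => ?_
    obtain ⟨c, hc⟩ := hdec a ha
    obtain ⟨d, hd⟩ := hdec b hb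
    have hax : ⁅a - c • x, x⁆ = 0 := by rw [← lie_skew, hxA _ hc, neg_zero]
    rw [← sub_add_cancel a (c • x), ← sub_add_cancel b (d • x)]
    rw [add_lie, lie_add, lie_add, hAA _ hc _ hd, lie_smul, hax, smul_lie, hxA _ hd]
    simp

lemma IsOneStep.bounds [FiniteDimensional F L] {B B' : LieIdeal F L} (h : IsOneStep B B')
    (hB : 2 * finrank F L ≤
        2 * finrank F (LieModule.ker F L B) + finrank F B * (finrank F B + 1) ∧
      LieAlgebra.derivedSeries F L (finrank F B) ≤ LieModule.ker F L B) :
    2 * finrank F L ≤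
        2 * finrank F (LieModule.ker F L B') + finrank F B' * (finrank F B' + 1) ∧
      LieAlgebra.derivedSeries F L (finrank F B') ≤ LieModule.ker F L B' := by
  rcases h.eq_or_finrank with rfl | hd
  · exact hB
  · refine ⟨?_, hd ▸ h.derivedSeries_succ_le_ker hB.2⟩
    have := h.finrank_ker_le
    rw [hd] at this ⊢
    linarith [hB.1]

lemma bounds_of_flag [FiniteDimensional F L] (A : LieIdeal F L) {C : ℕ → LieIdeal F L} {n : ℕ}
    (h0 : C 0 = ⊥) (hn : C n = ⊤) (hC : ∀ i < n, IsOneStep (C i) (C (i + 1))) :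
    2 * finrank F L ≤
        2 * finrank F (LieModule.ker F L A) + finrank F A * (finrank F A + 1) ∧
      LieAlgebra.derivedSeries F L (finrank F A) ≤ LieModule.ker F L A := by
  suffices h : ∀ i ≤ n, 2 * finrank F L ≤ 2 * finrank F (LieModule.ker F L ↥(A ⊓ C i)) +
        finrank F ↥(A ⊓ C i) * (finrank F ↥(A ⊓ C i) + 1) ∧
      LieAlgebra.derivedSeries F L (finrank F ↥(A ⊓ C i)) ≤ LieModule.ker F L ↥(A ⊓ C i) by
    have := h n le_rfl
    rwa [hn, inf_top_eq] at this
  intro i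
  induction i with
  | zero =>
    intro _
    have hker : LieModule.ker F L (⊥ : LieIdeal F L) = ⊤ :=
      eq_top_iff.2 fun z _ => mem_ker_iff.2 fun b hb => by
        rw [(LieSubmodule.mem_bot b).1 hb, lie_zero]
    have hdim : finrank F (⊤ : LieIdeal F L) = finrank F L := finrank_top F L
    rw [h0, inf_bot_eq, hker, hdim]
    exact ⟨Nat.le_add_right _ _, le_top⟩
  | succ i ih => exact fun hi => ((hC i hi).inf A).bounds (ih (by omega))

end LieIdeal

end

/-- If `L` is a finite-dimensional supersolvable Lie algebra with a maximal
abelian ideal `A` of dimension `k`, then `dim L ≤ k(k+3)/2` and `L` has derived length at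
most `k + 1`, i.e. `L^(k+1) = 0`. -/
theorem dim_le_and_derived_length_le (F L : Type*) [Field F] [LieRing L]
    [LieAlgebra F L] [FiniteDimensional F L] (hss : IsSupersolvable F L)
    (A : LieIdeal F L) (hA : IsLieAbelian A)
    (hAmax : ∀ B : LieIdeal F L, IsLieAbelian B → A ≤ B → B = A)
    (k : ℕ) (hk : Module.finrank F A = k) :
    Module.finrank F L ≤ k * (k + 3) / 2 ∧ LieAlgebra.derivedSeries F L (k + 1) = ⊥ := by
  obtain ⟨C, hmono, h0, hn, hdim⟩ := hss
  have hC : ∀ i < finrank F L, LieIdeal.IsOneStep (C i) (C (i + 1)) := fun i hi =>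
    LieIdeal.isOneStep_of_finrank (hmono i.le_succ) (by rw [hdim _ hi, hdim _ hi.le])
  have hker := LieIdeal.ker_le_of_maximal hA hAmax h0 hn hC
  obtain ⟨hle, hder⟩ := LieIdeal.bounds_of_flag A h0 hn hC
  have hkerdim : finrank F (LieModule.ker F L A) ≤ finrank F A :=
    Submodule.finrank_mono (s := (LieModule.ker F L A).toSubmodule) (t := A.toSubmodule) hker
  rw [hk] at hle hder hkerdim
  refine ⟨by rw [Nat.le_div_iff_mul_le two_pos]; linarith, ?_⟩
  rw [LieAlgebra.derivedSeries_def, LieAlgebra.derivedSeriesOfIdeal_succ, eq_bot_iff]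
  exact (LieSubmodule.mono_lie (hder.trans hker) (hder.trans hker)).trans
    ((LieSubmodule.lie_abelian_iff_lie_self_eq_bot A).1 hA).le
end

section
/- Let L be a finite-dimensional supersolvable Lie algebra of dimension n over a field F. Then β(L) ≥ ⌊(√(8n+9) − 3)/2⌋. -/
open Module

section

variable {F L : Type*} [Field F] [LieRing L] [LieAlgebra F L]

theorem Submodule.exists_sub_smul_mem_of_finrank_le_succ {V : Type*} [AddCommGroup V] [Module F V]
    [FiniteDimensional F V] {I J : Submodule F V} (hIJ : I ≤ J)
    (hd : finrank F J ≤ finrank F I + 1) {a : V} (haJ : a ∈ J) (haI : a ∉ I) {y : V}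
    (hy : y ∈ J) : ∃ c : F, y - c • a ∈ I := by
  have hlt : I < I ⊔ Submodule.span F {a} :=
    lt_of_le_of_ne le_sup_left fun h => haI <| by
      rw [h]; exact Submodule.mem_sup_right (Submodule.mem_span_singleton_self a)
  have hle : I ⊔ Submodule.span F {a} ≤ J :=
    sup_le hIJ ((Submodule.span_singleton_le_iff_mem _ _).2 haJ)
  have heq : I ⊔ Submodule.span F {a} = J := by
    refine Submodule.eq_of_le_of_finrank_le hle ?_
    have := Submodule.finrank_lt_finrank_of_lt hlt
    omega
  rw [← heq, Submodule.mem_sup] at hy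
  obtain ⟨u, hu, v, hv, rfl⟩ := hy
  obtain ⟨c, rfl⟩ := Submodule.mem_span_singleton.1 hv
  exact ⟨c, by simpa using hu⟩

theorem LieIdeal.mem_ker_iff_s8 {I : LieIdeal F L} {x : L} :
    x ∈ LieModule.ker F L I ↔ ∀ y ∈ I, ⁅x, y⁆ = 0 := by
  rw [LieModule.mem_ker]
  refine ⟨fun h y hy => congrArg Subtype.val (h ⟨y, hy⟩), fun h m => Subtype.ext (h m m.2)⟩

theorem LieIdeal.isLieAbelian_iff_lie_eq_zero {I : LieIdeal F L} :
    IsLieAbelian I ↔ ∀ x ∈ I, ∀ y ∈ I, ⁅x, y⁆ = 0 := by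
  refine ⟨fun h x hx y hy => ?_, fun h => ⟨fun x y => Subtype.ext (h x x.2 y y.2)⟩⟩
  exact congrArg Subtype.val (h.trivial ⟨x, hx⟩ ⟨y, hy⟩)

/-- Passing from the centralizer of `I` to that of an ideal `J ⊇ I` spanned by `I` and `a` lowers
the dimension by at most `dim J`. -/
theorem LieIdeal.finrank_ker_le_add [FiniteDimensional F L] {I J : LieIdeal F L} {a : L}
    (haJ : a ∈ J) (h : ∀ y ∈ J, ∃ c : F, y - c • a ∈ I) :
    finrank F (LieModule.ker F L I) ≤ finrank F (LieModule.ker F L J) + finrank F J := by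
  let Z : Submodule F L := (LieModule.ker F L I).toSubmodule
  let g : Z →ₗ[F] L := (LieModule.toEnd F L L a : L →ₗ[F] L).domRestrict Z
  have hg : ∀ x : Z, g x = ⁅a, (x : L)⁆ := fun _ => rfl
  have hrange : finrank F (LinearMap.range g) ≤ finrank F J := by
    refine Submodule.finrank_mono (t := J.toSubmodule) ?_
    rintro _ ⟨x, rfl⟩
    exact lie_mem_left F L J a x haJ
  have hker : finrank F (LinearMap.ker g) ≤ finrank F (LieModule.ker F L J) := by
    rw [← Submodule.finrank_map_subtype_eq]
    refine Submodule.finrank_mono (t := (LieModule.ker F L J).toSubmodule) ?_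
    rintro _ ⟨x, hx, rfl⟩
    refine LieIdeal.mem_ker_iff_s8.2 fun y hy => ?_
    obtain ⟨c, hc⟩ := h y hy
    have hxa : ⁅(x : L), a⁆ = 0 := by
      rw [← lie_skew, ← hg x, LinearMap.mem_ker.1 hx, neg_zero]
    have h0 := LieIdeal.mem_ker_iff_s8.1 x.2 _ hc
    simpa [hxa] using h0
  have := LinearMap.finrank_range_add_finrank_ker g
  change finrank F Z ≤ _
  omega

theorem IsSupersolvable.exists_chain [FiniteDimensional F L] (hss : IsSupersolvable F L) :
    ∃ C : ℕ → LieIdeal F L, Monotone C ∧ C 0 = ⊥ ∧ C (finrank F L) = ⊤ ∧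
      ∀ i < finrank F L, ∀ a ∈ C (i + 1), a ∉ C i → ∀ y ∈ C (i + 1), ∃ c : F, y - c • a ∈ C i := by
  obtain ⟨C, hm, h0, h1, hd⟩ := hss
  refine ⟨C, hm, h0, h1, fun i hi a ha ha' y hy => ?_⟩
  refine Submodule.exists_sub_smul_mem_of_finrank_le_succ (I := (C i).toSubmodule)
    (J := (C (i + 1)).toSubmodule) (hm i.le_succ) ?_ ha ha' hy
  exact (hd (i + 1) hi).le.trans (Nat.succ_le_succ (hd i hi.le).ge)

/-- A maximal abelian ideal of a supersolvable Lie algebra contains its centralizer. -/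
theorem IsSupersolvable.ker_le_of_maximal [FiniteDimensional F L] (hss : IsSupersolvable F L)
    {A : LieIdeal F L} (hA : Maximal (fun I : LieIdeal F L => IsLieAbelian I) A) :
    LieModule.ker F L A ≤ A := by
  obtain ⟨C, -, h0, h1, hC⟩ := hss.exists_chain
  have hAA := LieIdeal.isLieAbelian_iff_lie_eq_zero.1 hA.prop
  suffices H : ∀ i ≤ finrank F L, C i ⊓ LieModule.ker F L A ≤ A by
    simpa [h1] using H _ le_rfl
  intro i
  induction i with
  | zero => simp [h0]
  | succ i ih =>
    intro hi
    have hlie : ∀ x ∈ C (i + 1) ⊓ LieModule.ker F L A, ∀ y ∈ C (i + 1) ⊓ LieModule.ker F L A,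
        ⁅x, y⁆ = 0 := by
      rintro x ⟨hx, hx'⟩ y ⟨hy, hy'⟩
      by_cases hxi : x ∈ C i
      · rw [← lie_skew, LieIdeal.mem_ker_iff_s8.1 hy' x (ih (by omega) ⟨hxi, hx'⟩), neg_zero]
      · obtain ⟨c, hc⟩ := hC i hi x hx hxi y hy
        have hz : y - c • x ∈ LieModule.ker F L A :=
          sub_mem hy' ((LieModule.ker F L A).smul_mem c hx')
        simpa using LieIdeal.mem_ker_iff_s8.1 hx' _ (ih (by omega) ⟨hc, hz⟩)
    have hB : IsLieAbelian (A ⊔ C (i + 1) ⊓ LieModule.ker F L A : LieIdeal F L) := by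
      rw [LieIdeal.isLieAbelian_iff_lie_eq_zero]
      intro x hx y hy
      obtain ⟨a, ha, u, hu, rfl⟩ := (LieSubmodule.mem_sup _ _ _).1 hx
      obtain ⟨b, hb, v, hv, rfl⟩ := (LieSubmodule.mem_sup _ _ _).1 hy
      have hav : ⁅a, v⁆ = 0 := by
        rw [← lie_skew, LieIdeal.mem_ker_iff_s8.1 hv.2 a ha, neg_zero]
      simp [hAA a ha b hb, hav, LieIdeal.mem_ker_iff_s8.1 hu.2 b hb, hlie u hu v hv]
    exact le_sup_right.trans (hA.le_of_ge hB le_sup_left)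

theorem IsSupersolvable.two_mul_finrank_le [FiniteDimensional F L] (hss : IsSupersolvable F L)
    (A : LieIdeal F L) :
    2 * finrank F L ≤ 2 * finrank F (LieModule.ker F L A) + finrank F A * (finrank F A + 1) := by
  obtain ⟨C, hm, h0, h1, hC⟩ := hss.exists_chain
  suffices H : ∀ i ≤ finrank F L, 2 * finrank F L ≤
      2 * finrank F (LieModule.ker F L (A ⊓ C i : LieIdeal F L)) +
        finrank F (A ⊓ C i : LieIdeal F L) * (finrank F (A ⊓ C i : LieIdeal F L) + 1) by
    have := H _ le_rfl
    rwa [h1, inf_top_eq] at this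
  intro i
  induction i with
  | zero =>
    intro _
    have hk : LieModule.ker F L (A ⊓ C 0 : LieIdeal F L) = ⊤ := by
      refine eq_top_iff.2 fun x _ => LieIdeal.mem_ker_iff_s8.2 fun y hy => ?_
      rw [h0, inf_bot_eq, LieSubmodule.mem_bot] at hy
      simp [hy]
    have ht : finrank F (⊤ : LieIdeal F L) = finrank F L := finrank_top F L
    rw [hk, ht]
    exact Nat.le_add_right _ _
  | succ i ih =>
    intro hi
    have hIJ : A ⊓ C i ≤ A ⊓ C (i + 1) := inf_le_inf_left A (hm i.le_succ)
    have hprev := ih (by omega)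
    rcases hIJ.eq_or_lt with heq | hlt
    · rwa [← heq]
    obtain ⟨a, ⟨haA, haC⟩, ha⟩ := SetLike.exists_of_lt hlt
    have hfin : finrank F (A ⊓ C i : LieIdeal F L) < finrank F (A ⊓ C (i + 1) : LieIdeal F L) :=
      Submodule.finrank_lt_finrank_of_lt (s := (A ⊓ C i).toSubmodule)
        (t := (A ⊓ C (i + 1)).toSubmodule) hlt
    have hker := LieIdeal.finrank_ker_le_add (I := A ⊓ C i) (J := A ⊓ C (i + 1)) ⟨haA, haC⟩
      fun y hy => by
        obtain ⟨c, hc⟩ := hC i hi a haC (fun h => ha ⟨haA, h⟩) y hy.2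
        exact ⟨c, sub_mem hy.1 (A.smul_mem c haA), hc⟩
    nlinarith

theorem bddAbove_finrank_abelian_ideals [FiniteDimensional F L] :
    BddAbove {d | ∃ I : LieIdeal F L, IsLieAbelian I ∧ finrank F I = d} := by
  refine ⟨finrank F L, ?_⟩
  rintro _ ⟨I, -, rfl⟩
  exact Submodule.finrank_le I.toSubmodule

theorem exists_maximal_abelian_ideal_finrank_eq_betaInv [FiniteDimensional F L] :
    ∃ A : LieIdeal F L, Maximal (fun I : LieIdeal F L => IsLieAbelian I) A ∧
      finrank F A = betaInv F L := by
  have hne : {d | ∃ I : LieIdeal F L, IsLieAbelian I ∧ finrank F I = d}.Nonempty :=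
    ⟨_, ⊥, inferInstance, rfl⟩
  obtain ⟨A, hA, hd⟩ := Nat.sSup_mem hne bddAbove_finrank_abelian_ideals
  refine ⟨A, ⟨hA, fun B hB hAB => ?_⟩, hd⟩
  have hle : finrank F B ≤ finrank F A := by
    rw [hd]; exact le_csSup bddAbove_finrank_abelian_ideals ⟨B, hB, rfl⟩
  exact (Submodule.eq_of_le_of_finrank_le (S₁ := A.toSubmodule) (S₂ := B.toSubmodule) hAB hle).ge

end

/-- If `L` is a finite-dimensional supersolvable Lie algebra of dimension
`n`, then `β(L) ≥ ⌊(√(8n+9) − 3)/2⌋`. -/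
theorem betaInv_ge_sqrt_bound (F L : Type*) [Field F] [LieRing L] [LieAlgebra F L]
    [FiniteDimensional F L] (hss : IsSupersolvable F L)
    (n : ℕ) (hn : Module.finrank F L = n) :
    ⌊(Real.sqrt (8 * n + 9) - 3) / 2⌋₊ ≤ betaInv F L := by
  obtain ⟨A, hA, hd⟩ := exists_maximal_abelian_ideal_finrank_eq_betaInv (F := F) (L := L)
  have hker : finrank F (LieModule.ker F L A) ≤ finrank F A :=
    Submodule.finrank_mono (s := (LieModule.ker F L A).toSubmodule) (t := A.toSubmodule)
      (hss.ker_le_of_maximal hA)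
  have hbound := hss.two_mul_finrank_le A
  rw [hn] at hbound
  rw [hd] at hker hbound
  have hnat : 2 * n ≤ 2 * betaInv F L + betaInv F L * (betaInv F L + 1) := by omega
  have hreal : (2 * n : ℝ) ≤ 2 * betaInv F L + betaInv F L * (betaInv F L + 1) := by
    exact_mod_cast hnat
  have hsqrt : Real.sqrt (8 * n + 9) ≤ 2 * betaInv F L + 3 := by
    refine Real.sqrt_le_iff.2 ⟨by positivity, ?_⟩
    nlinarith
  exact Nat.floor_le_of_le (by linarith)
end

section
/- Let L be a finite-dimensional Lie algebra over a field F, let A be an abelian subalgebra of L, and let K = A + F·e₁ be a subalgebra of L properly containing A (so e₁ ∉ A). Suppose there is an x ∈ L such that [x,K] ⊆ K but [x,A] ⊄ A. Then either K is abelian, or K² = [K,K] is one-dimensional and the center Z(K) of K satisfies dim(A) − dim(Z(K) ∩ A) ≤ 1 (i.e. Z(K) has codimension at most one in A). -/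
open Module

/-- If `K = A + F·e₁` and `w ∈ K` lies outside `A`, then `K = A + F·w`. -/
theorem Submodule.exists_eq_add_smul_of_eq_sup_span_singleton {F V : Type*} [Field F]
    [AddCommGroup V] [Module F V] {A K : Submodule F V} {e₁ w : V}
    (hK : K = A ⊔ Submodule.span F {e₁}) (hwK : w ∈ K) (hwA : w ∉ A) {k : V} (hk : k ∈ K) :
    ∃ a ∈ A, ∃ c : F, k = a + c • w := by
  rw [hK, Submodule.mem_sup] at hwK hk
  obtain ⟨a₁, ha₁, y, hy, rfl⟩ := hwK
  obtain ⟨a₂, ha₂, y₂, hy₂, rfl⟩ := hk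
  obtain ⟨m, rfl⟩ := Submodule.mem_span_singleton.1 hy
  obtain ⟨n, rfl⟩ := Submodule.mem_span_singleton.1 hy₂
  have hm : m ≠ 0 := by
    rintro rfl
    simp [ha₁] at hwA
  refine ⟨a₂ - (n * m⁻¹) • a₁, A.sub_mem ha₂ (A.smul_mem _ ha₁), n * m⁻¹, ?_⟩
  rw [smul_add, smul_smul, inv_mul_cancel_right₀ hm]
  abel

/-- Suppose `K = A + F·w` with `A` abelian. If `ad x` preserves `K` and sends some `a₀ ∈ A`
to `w`, then `ad w` maps `A` into the line spanned by `[w, a₀]`. -/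
theorem lie_mem_span_singleton_of_derivation {F L : Type*} [Field F] [LieRing L]
    [LieAlgebra F L] {A K : LieSubalgebra F L} (hA : ∀ a ∈ A, ∀ b ∈ A, ⁅a, b⁆ = 0)
    (hAK : A ≤ K) {x a₀ : L} (ha₀ : a₀ ∈ A) (hxK : ∀ y ∈ K, ⁅x, y⁆ ∈ K)
    (hK : ∀ k ∈ K, ∃ a ∈ A, ∃ c : F, k = a + c • ⁅x, a₀⁆) {b : L} (hb : b ∈ A) :
    ⁅⁅x, a₀⁆, b⁆ ∈ Submodule.span F {⁅⁅x, a₀⁆, a₀⁆} := by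
  obtain ⟨a, ha, c, hc⟩ := hK _ (hxK b (hAK hb))
  have h := leibniz_lie x a₀ b
  rw [hA a₀ ha₀ b hb, lie_zero, hc, lie_add, hA a₀ ha₀ a ha, zero_add, lie_smul,
    ← lie_skew a₀, smul_neg, ← sub_eq_add_neg] at h
  exact Submodule.mem_span_singleton.2 ⟨c, (sub_eq_zero.1 h.symm).symm⟩

/-- Let `A` be an abelian subalgebra of `L` and let `K = A + F·e₁` be a
subalgebra of `L` properly containing `A`. Suppose there is an `x ∈ L` with `[x,K] ⊆ K` but
`[x,A] ⊄ A`. Then either `K` is abelian, or `K²` is one-dimensional and `Z(K)` has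
codimension at most one in `A`. -/
theorem abelian_or_derived_one_dim (F L : Type*) [Field F] [LieRing L] [LieAlgebra F L]
    [FiniteDimensional F L] (A : LieSubalgebra F L) (hA : IsLieAbelian A)
    (e₁ : L) (he₁ : e₁ ∉ A) (K : LieSubalgebra F L)
    (hK : K.toSubmodule = A.toSubmodule ⊔ Submodule.span F {e₁})
    (x : L) (hxK : ∀ y ∈ K, ⁅x, y⁆ ∈ K) (hxA : ¬ ∀ y ∈ A, ⁅x, y⁆ ∈ A) :
    IsLieAbelian K ∨
      (Module.finrank F (LieAlgebra.derivedSeries F K 1) = 1 ∧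
        Module.finrank F A ≤
          Module.finrank F ↥(K.toSubmodule ⊓ lieCentralizer F L (K : Set L) ⊓
            A.toSubmodule) + 1) := by
  push Not at hxA
  obtain ⟨a₀, ha₀, hwA⟩ := hxA
  have hAK : A ≤ K := fun a ha => by
    rw [← LieSubalgebra.mem_toSubmodule, hK]
    exact Submodule.mem_sup_left ha
  have hwK : ⁅x, a₀⁆ ∈ K := hxK _ (hAK ha₀)
  have hab : ∀ a ∈ A, ∀ b ∈ A, ⁅a, b⁆ = 0 := fun a ha b hb =>
    congrArg Subtype.val (hA.trivial ⟨a, ha⟩ ⟨b, hb⟩)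
  have hdec : ∀ k ∈ K, ∃ a ∈ A, ∃ c : F, k = a + c • ⁅x, a₀⁆ := fun k hk =>
    Submodule.exists_eq_add_smul_of_eq_sup_span_singleton hK hwK hwA hk
  have hspan : ∀ b ∈ A, ⁅⁅x, a₀⁆, b⁆ ∈ Submodule.span F {⁅⁅x, a₀⁆, a₀⁆} := fun b hb =>
    lie_mem_span_singleton_of_derivation hab hAK ha₀ hxK hdec hb
  generalize ⁅x, a₀⁆ = w at hwA hwK hdec hspan
  have hlie : ∀ k ∈ K, ∀ l ∈ K, ⁅k, l⁆ ∈ Submodule.span F {⁅w, a₀⁆} := by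
    intro k hk l hl
    obtain ⟨a, ha, c, rfl⟩ := hdec k hk
    obtain ⟨b, hb, d, rfl⟩ := hdec l hl
    have h : ⁅a + c • w, b + d • w⁆ = c • ⁅w, b⁆ - d • ⁅w, a⁆ := by
      simp only [add_lie, lie_add, smul_lie, lie_smul, lie_self, smul_zero, hab a ha b hb]
      rw [← lie_skew a w]
      module
    rw [h]
    exact sub_mem (Submodule.smul_mem _ _ (hspan b hb)) (Submodule.smul_mem _ _ (hspan a ha))
  by_cases hz : ⁅w, a₀⁆ = 0
  · left
    refine ⟨fun k l => Subtype.ext ?_⟩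
    simpa [hz] using hlie k k.2 l l.2
  right
  constructor
  · let w' : K := ⟨w, hwK⟩
    let a' : K := ⟨a₀, hAK ha₀⟩
    have hz' : ⁅w', a'⁆ ≠ 0 := fun h => hz (congrArg Subtype.val h)
    have hD : (LieAlgebra.derivedSeries F K 1).toSubmodule = Submodule.span F {⁅w', a'⁆} := by
      rw [LieAlgebra.derivedSeries_def, LieAlgebra.derivedSeriesOfIdeal_succ,
        LieAlgebra.derivedSeriesOfIdeal_zero, LieSubmodule.lieIdeal_oper_eq_linear_span']
      apply le_antisymm
      · rw [Submodule.span_le]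
        rintro _ ⟨k, -, l, -, rfl⟩
        obtain ⟨c, hc⟩ := Submodule.mem_span_singleton.1 (hlie k k.2 l l.2)
        exact Submodule.mem_span_singleton.2 ⟨c, Subtype.ext hc⟩
      · exact Submodule.span_mono (Set.singleton_subset_iff.2 ⟨w', trivial, a', trivial, rfl⟩)
    change Module.finrank F (LieAlgebra.derivedSeries F K 1).toSubmodule = 1
    rw [hD, finrank_span_singleton hz']
  · let f : A.toSubmodule →ₗ[F] L := (LieAlgebra.ad F L w : L →ₗ[F] L).domRestrict A.toSubmodule
    have hrange : Module.finrank F (LinearMap.range f) ≤ 1 := by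
      rw [← finrank_span_singleton (K := F) hz]
      refine Submodule.finrank_mono ?_
      rintro _ ⟨b, rfl⟩
      exact hspan b b.2
    have hker : (LinearMap.ker f).map A.toSubmodule.subtype ≤
        K.toSubmodule ⊓ lieCentralizer F L (K : Set L) ⊓ A.toSubmodule := by
      rintro _ ⟨b, hb, rfl⟩
      have hwb : ⁅w, (b : L)⁆ = 0 := hb
      refine ⟨⟨hAK b.2, fun k hk => ?_⟩, b.2⟩
      obtain ⟨a, ha, c, rfl⟩ := hdec k hk
      rw [Submodule.subtype_apply, lie_add, hab b b.2 a ha, lie_smul, ← lie_skew, hwb]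
      simp
    have hkerrank := Submodule.finrank_mono hker
    rw [Submodule.finrank_map_subtype_eq] at hkerrank
    have hsum := LinearMap.finrank_range_add_finrank_ker f
    change Module.finrank F A.toSubmodule ≤ _
    omega
end

section
/- Let L be a finite-dimensional supersolvable Lie algebra over a field F and let A be an abelian subalgebra of maximal dimension in L (so dim A = α(L)). If A ⊂ K where K is an ideal of L and A has codimension 1 in K, then α(L) = β(L). -/
open Module

section Submodule

variable {F V : Type*} [Field F] [AddCommGroup V] [Module F V]

theorem Submodule.mem_sup_span_singleton_of_sub_smul_mem {U : Submodule F V} {x w : V} {t : F}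
    (h : w - t • x ∈ U) : w ∈ U ⊔ Submodule.span F {x} :=
  Submodule.mem_sup.2 ⟨_, h, _, Submodule.mem_span_singleton.2 ⟨t, rfl⟩, sub_add_cancel _ _⟩

variable [FiniteDimensional F V]

theorem Submodule.exists_sub_smul_mem_of_finrank_le_succ_s11 {U W : Submodule F V} (hUW : U ≤ W)
    (hdim : finrank F W ≤ finrank F U + 1) {x : V} (hx : x ∈ W) (hxU : x ∉ U) {w : V}
    (hw : w ∈ W) : ∃ t : F, w - t • x ∈ U := by
  have hlt : U < U ⊔ Submodule.span F {x} :=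
    left_lt_sup.2 fun h => hxU (h (Submodule.mem_span_singleton_self x))
  have hle : U ⊔ Submodule.span F {x} ≤ W :=
    sup_le hUW ((Submodule.span_singleton_le_iff_mem x W).2 hx)
  have heq : U ⊔ Submodule.span F {x} = W :=
    Submodule.eq_of_le_of_finrank_le hle (hdim.trans (Submodule.finrank_lt_finrank_of_lt hlt))
  rw [← heq] at hw
  obtain ⟨u, hu, v, hv, rfl⟩ := Submodule.mem_sup.1 hw
  obtain ⟨t, rfl⟩ := Submodule.mem_span_singleton.1 hv
  exact ⟨t, by simpa using hu⟩

theorem Submodule.finrank_le_succ_of_le_sup_span_singleton {U W : Submodule F V} {x : V}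
    (h : W ≤ U ⊔ Submodule.span F {x}) : finrank F W ≤ finrank F U + 1 := by
  have h₁ := Submodule.finrank_mono h
  have h₂ := Submodule.finrank_add_le_finrank_add_finrank U (Submodule.span F {x})
  have h₃ : finrank F (Submodule.span F {x}) ≤ 1 := by simpa using finrank_span_le_card (R := F) {x}
  omega

end Submodule

theorem Nat.exists_eq_of_le_of_succ_le {g : ℕ → ℕ} {m n : ℕ} (h₀ : g 0 ≤ m) (hn : m ≤ g n)
    (hg : ∀ i < n, g (i + 1) ≤ g i + 1) : ∃ i ≤ n, g i = m := by
  induction n with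
  | zero => exact ⟨0, le_rfl, le_antisymm h₀ hn⟩
  | succ n ih =>
    by_cases h : m ≤ g n
    · obtain ⟨i, hi, rfl⟩ := ih h fun i hi => hg i (by omega)
      exact ⟨i, by omega, rfl⟩
    · exact ⟨n + 1, le_rfl, by have := hg n (by omega); omega⟩

section Lie

variable {F L : Type*} [Field F] [LieRing L] [LieAlgebra F L]

theorem LieSubalgebra.isLieAbelian_of_forall {A : LieSubalgebra F L}
    (h : ∀ x ∈ A, ∀ y ∈ A, ⁅x, y⁆ = 0) : IsLieAbelian A :=
  ⟨fun x y => Subtype.ext (h x x.2 y y.2)⟩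

theorem LieSubalgebra.lie_eq_zero_of_isLieAbelian {A : LieSubalgebra F L} (hA : IsLieAbelian A)
    {x y : L} (hx : x ∈ A) (hy : y ∈ A) : ⁅x, y⁆ = 0 :=
  congrArg Subtype.val (hA.trivial ⟨x, hx⟩ ⟨y, hy⟩)

/-- The center of an ideal, as an ideal of the ambient Lie algebra. -/
def LieIdeal.centerIdeal (K : LieIdeal F L) : LieIdeal F L where
  carrier := {z | z ∈ K ∧ ∀ k ∈ K, ⁅z, k⁆ = 0}
  add_mem' := fun ha hb =>
    ⟨add_mem ha.1 hb.1, fun k hk => by rw [add_lie, ha.2 k hk, hb.2 k hk, add_zero]⟩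
  zero_mem' := ⟨zero_mem K, fun k _ => zero_lie k⟩
  smul_mem' := fun c _ ha => ⟨K.smul_mem c ha.1, fun k hk => by rw [smul_lie, ha.2 k hk, smul_zero]⟩
  lie_mem := fun {x} _ ha =>
    ⟨K.lie_mem ha.1, fun k hk => by
      rw [lie_lie, ha.2 k hk, ha.2 _ (K.lie_mem hk), lie_zero, sub_zero]⟩

theorem LieIdeal.mem_centerIdeal {K : LieIdeal F L} {z : L} :
    z ∈ K.centerIdeal ↔ z ∈ K ∧ ∀ k ∈ K, ⁅z, k⁆ = 0 :=
  Iff.rfl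

theorem LieIdeal.centerIdeal_le (K : LieIdeal F L) : K.centerIdeal ≤ K :=
  fun _ h => h.1

variable [FiniteDimensional F L]

theorem finrank_le_alphaInv {A : LieSubalgebra F L} (hA : IsLieAbelian A) :
    finrank F A ≤ alphaInv F L :=
  le_csSup ⟨finrank F L, by rintro _ ⟨B, -, rfl⟩; exact Submodule.finrank_le B.toSubmodule⟩
    ⟨A, hA, rfl⟩

theorem LieIdeal.finrank_le_alphaInv {I : LieIdeal F L} (hI : ∀ x ∈ I, ∀ y ∈ I, ⁅x, y⁆ = 0) :
    finrank F I ≤ alphaInv F L :=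
  _root_.finrank_le_alphaInv (A := I.toLieSubalgebra)
    (LieSubalgebra.isLieAbelian_of_forall hI)

theorem betaInv_le_alphaInv : betaInv F L ≤ alphaInv F L := by
  refine csSup_le ⟨_, ⊥, inferInstance, rfl⟩ ?_
  rintro _ ⟨I, hI, rfl⟩
  exact finrank_le_alphaInv (A := I.toLieSubalgebra) hI

theorem LieIdeal.finrank_le_betaInv {I : LieIdeal F L} (hI : ∀ x ∈ I, ∀ y ∈ I, ⁅x, y⁆ = 0) :
    finrank F I ≤ betaInv F L :=
  le_csSup ⟨finrank F L, by rintro _ ⟨J, -, rfl⟩; exact Submodule.finrank_le J.toSubmodule⟩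
    ⟨I, ⟨fun x y => Subtype.ext (hI x x.2 y y.2)⟩, rfl⟩

/-- In a supersolvable Lie algebra, there are ideals of every intermediate dimension between two
nested ideals. -/
theorem IsSupersolvable.exists_ideal_finrank_eq (hss : IsSupersolvable F L) {Z K : LieIdeal F L}
    (hZK : Z ≤ K) {m : ℕ} (hZ : finrank F Z ≤ m) (hK : m ≤ finrank F K) :
    ∃ I : LieIdeal F L, Z ≤ I ∧ I ≤ K ∧ finrank F I = m := by
  obtain ⟨C, hmono, h₀, htop, hdim⟩ := hss
  have hstep : ∀ i < finrank F L, finrank F (Z ⊔ K ⊓ C (i + 1) : LieIdeal F L) ≤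
      finrank F (Z ⊔ K ⊓ C i : LieIdeal F L) + 1 := by
    intro i hi
    by_cases h : K ⊓ C (i + 1) ≤ C i
    · have : Z ⊔ K ⊓ C (i + 1) ≤ Z ⊔ K ⊓ C i := sup_le_sup_left (le_inf inf_le_left h) _
      exact (Submodule.finrank_mono this).trans (Nat.le_succ _)
    · obtain ⟨x, hx, hxC⟩ := SetLike.not_le_iff_exists.1 h
      obtain ⟨hxK, hxS⟩ := (LieSubmodule.mem_inf _ _ x).1 hx
      refine Submodule.finrank_le_succ_of_le_sup_span_singleton
        (U := (Z ⊔ K ⊓ C i).toSubmodule) (W := (Z ⊔ K ⊓ C (i + 1)).toSubmodule) (x := x) ?_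
      rw [LieSubmodule.sup_toSubmodule]
      refine sup_le (le_sup_of_le_left (le_sup_left (a := Z) (b := K ⊓ C i))) fun w hw => ?_
      obtain ⟨hwK, hwS⟩ := (LieSubmodule.mem_inf _ _ w).1 hw
      obtain ⟨t, ht⟩ := Submodule.exists_sub_smul_mem_of_finrank_le_succ_s11
        (U := (C i).toSubmodule) (W := (C (i + 1)).toSubmodule) (hmono i.le_succ)
        (((hdim (i + 1) hi).trans (congrArg Nat.succ (hdim i hi.le).symm)).le) hxS hxC hwS
      refine Submodule.mem_sup_span_singleton_of_sub_smul_mem (t := t) ?_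
      exact (le_sup_right : K ⊓ C i ≤ Z ⊔ K ⊓ C i)
        ((LieSubmodule.mem_inf _ _ _).2 ⟨sub_mem hwK (K.smul_mem t hxK), ht⟩)
  obtain ⟨i, -, hi⟩ := Nat.exists_eq_of_le_of_succ_le
    (g := fun i => finrank F (Z ⊔ K ⊓ C i : LieIdeal F L)) (m := m) (n := finrank F L)
    (by rwa [h₀, inf_bot_eq, sup_bot_eq])
    (by rwa [htop, inf_top_eq, sup_eq_right.2 hZK]) hstep
  exact ⟨_, le_sup_left, sup_le hZK inf_le_left, hi⟩

theorem LieIdeal.lie_eq_zero_of_finrank_le_centerIdeal_succ {K I : LieIdeal F L}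
    (hZI : K.centerIdeal ≤ I) (hIK : I ≤ K) (hdim : finrank F I ≤ finrank F K.centerIdeal + 1) :
    ∀ x ∈ I, ∀ y ∈ I, ⁅x, y⁆ = 0 := by
  intro x hx y hy
  by_cases hxZ : x ∈ K.centerIdeal
  · exact hxZ.2 y (hIK hy)
  · obtain ⟨t, ht⟩ := Submodule.exists_sub_smul_mem_of_finrank_le_succ_s11
      (U := K.centerIdeal.toSubmodule) (W := I.toSubmodule) hZI hdim hx hxZ hy
    have h : ⁅y - t • x, x⁆ = 0 := (LieIdeal.mem_centerIdeal.1 ht).2 x (hIK hx)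
    rw [sub_lie, smul_lie, lie_self, smul_zero, sub_zero] at h
    rw [← lie_skew, h, neg_zero]

/-- If an abelian subalgebra of codimension one in an ideal `K` is not an ideal, then it exceeds
the center of `K` by at most one dimension. -/
theorem LieIdeal.finrank_le_finrank_centerIdeal_succ {A : LieSubalgebra F L}
    (hA : IsLieAbelian A) {K : LieIdeal F L} (hAK : A.toSubmodule ≤ K.toSubmodule)
    (hcodim : finrank F K = finrank F A + 1) {z a : L} (ha : a ∈ A) (hza : ⁅z, a⁆ ∉ A) :
    finrank F A ≤ finrank F K.centerIdeal + 1 := by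
  have hdecomp : ∀ k ∈ K, ∃ t : F, k - t • ⁅z, a⁆ ∈ A := fun k hk =>
    Submodule.exists_sub_smul_mem_of_finrank_le_succ_s11 (U := A.toSubmodule) (W := K.toSubmodule)
      hAK hcodim.le (K.lie_mem (hAK ha)) hza hk
  refine Submodule.finrank_le_succ_of_le_sup_span_singleton (U := K.centerIdeal.toSubmodule)
    (W := A.toSubmodule) (x := a) fun b hb => ?_
  obtain ⟨t, ht⟩ := hdecomp ⁅z, b⁆ (K.lie_mem (hAK hb))
  have hbtA : b - t • a ∈ A := sub_mem hb (A.smul_mem t ha)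
  refine Submodule.mem_sup_span_singleton_of_sub_smul_mem (t := t)
    (LieIdeal.mem_centerIdeal.2 ⟨hAK hbtA, fun k hk => ?_⟩)
  have hzero : ⁅b - t • a, ⁅z, a⁆⁆ = 0 := by
    have h₁ : ⁅a, ⁅z, b⁆ - t • ⁅z, a⁆⁆ = 0 := LieSubalgebra.lie_eq_zero_of_isLieAbelian hA ha ht
    have h₂ : ⁅z, ⁅a, b⁆⁆ = 0 := by
      rw [LieSubalgebra.lie_eq_zero_of_isLieAbelian hA ha hb, lie_zero]
    rw [leibniz_lie, ← lie_skew ⁅z, a⁆ b] at h₂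
    rw [lie_sub, lie_smul] at h₁
    rw [sub_lie, smul_lie, ← sub_eq_zero.1 h₁]
    exact sub_eq_zero.2 (neg_add_eq_zero.1 h₂)
  obtain ⟨s, hs⟩ := hdecomp k hk
  have h := LieSubalgebra.lie_eq_zero_of_isLieAbelian hA hbtA hs
  rwa [lie_sub, lie_smul, hzero, smul_zero, sub_zero] at h

end Lie

/-- Let `L` be a finite-dimensional supersolvable Lie algebra and let `A`
be an abelian subalgebra of maximal dimension (`dim A = α(L)`). If `A ⊂ K` where `K` is an
ideal of `L` and `A` has codimension `1` in `K`, then `α(L) = β(L)`. -/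
theorem alphaInv_eq_betaInv_of_codim_one_in_ideal (F L : Type*) [Field F] [LieRing L]
    [LieAlgebra F L] [FiniteDimensional F L] (hss : IsSupersolvable F L)
    (A : LieSubalgebra F L) (hA : IsLieAbelian A)
    (hAdim : Module.finrank F A = alphaInv F L)
    (K : LieIdeal F L) (hAK : A.toSubmodule ≤ K.toSubmodule)
    (hcodim : Module.finrank F K = Module.finrank F A + 1) :
    alphaInv F L = betaInv F L := by
  refine le_antisymm ?_ betaInv_le_alphaInv
  rw [← hAdim]
  by_cases hideal : ∀ z : L, ∀ a ∈ A, ⁅z, a⁆ ∈ A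
  · exact LieIdeal.finrank_le_betaInv
      (I := { A.toSubmodule with lie_mem := fun {z a} ha => hideal z a ha })
      fun x hx y hy => LieSubalgebra.lie_eq_zero_of_isLieAbelian hA hx hy
  · push Not at hideal
    obtain ⟨z, a, ha, hza⟩ := hideal
    have hZ := LieIdeal.finrank_le_finrank_centerIdeal_succ hA hAK hcodim ha hza
    have hZle : finrank F K.centerIdeal ≤ finrank F A := by
      rw [hAdim]
      exact LieIdeal.finrank_le_alphaInv fun x hx y hy => hx.2 y hy.1
    obtain ⟨I, hZI, hIK, hI⟩ :=
      hss.exists_ideal_finrank_eq K.centerIdeal_le hZle (hcodim.symm ▸ Nat.le_succ _)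
    rw [← hI] at hZ ⊢
    exact LieIdeal.finrank_le_betaInv
      (LieIdeal.lie_eq_zero_of_finrank_le_centerIdeal_succ hZI hIK hZ)
end

section
/- Let L be a finite-dimensional supersolvable Lie algebra of dimension n over a field F with α(L) = n − 2. Then β(L) = n − 2. -/
open Module

section Helpers

variable {F L : Type*} [Field F] [LieRing L] [LieAlgebra F L]

theorem Submodule.exists_sub_smul_mem_of_finrank_le [FiniteDimensional F L]
    {A M : Submodule F L} (hAM : A ≤ M)
    (hr : finrank F M ≤ finrank F A + 1) {x : L} (hx : x ∈ M) (hxA : x ∉ A) {m : L}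
    (hm : m ∈ M) : ∃ c : F, m - c • x ∈ A := by
  have hle : A ⊔ F ∙ x ≤ M :=
    sup_le hAM ((Submodule.span_singleton_le_iff_mem _ _).2 hx)
  have he := Submodule.eq_of_le_of_finrank_le hle
    (hr.trans (Submodule.finrank_sup_span_singleton hxA).ge)
  rw [← he, Submodule.mem_sup] at hm
  obtain ⟨a, ha, w, hw, rfl⟩ := hm
  obtain ⟨c, rfl⟩ := Submodule.mem_span_singleton.1 hw
  exact ⟨c, by simpa using ha⟩

/-- In a supersolvable Lie algebra, a `P`-stable subspace `T` not contained in `S` has a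
one-dimensional `P`-stable section `(K + F y) / K` with `K ≤ S` and `y ∉ S`. -/
theorem IsSupersolvable.exists_stable_section [FiniteDimensional F L]
    (hss : IsSupersolvable F L) {P S T : Submodule F L}
    (hT : ∀ z ∈ P, ∀ y ∈ T, ⁅z, y⁆ ∈ T) (h : ¬ T ≤ S) :
    ∃ K : Submodule F L, K ≤ S ∧ (∀ z ∈ P, ∀ k ∈ K, ⁅z, k⁆ ∈ K) ∧
      ∃ y ∈ T, y ∉ S ∧ ∀ z ∈ P, ∃ c : F, ⁅z, y⁆ - c • y ∈ K := by
  classical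
  obtain ⟨C, hmono, h0, htop, hdim⟩ := hss
  have hex : ∃ i, ¬ (C i).toSubmodule ⊓ T ≤ S := ⟨_, by rw [htop]; simpa using h⟩
  have hlast : Nat.find hex ≤ finrank F L :=
    Nat.find_min' hex (by rw [htop]; simpa using h)
  obtain ⟨j, hj⟩ : ∃ j, Nat.find hex = j + 1 := by
    refine Nat.exists_eq_succ_of_ne_zero fun h0' => ?_
    have := Nat.find_spec hex
    rw [h0', h0] at this
    simp at this
  have hspec := Nat.find_spec hex
  have hKS : (C j).toSubmodule ⊓ T ≤ S := not_not.1 (Nat.find_min hex (by omega))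
  rw [hj] at hspec hlast
  obtain ⟨y, ⟨hyC, hyT⟩, hyS⟩ := SetLike.not_le_iff_exists.1 hspec
  refine ⟨(C j).toSubmodule ⊓ T, hKS,
    fun z hz k hk => ⟨lie_mem_right F L (C j) z k hk.1, hT z hz k hk.2⟩, y, hyT, hyS,
    fun z hz => ?_⟩
  have hyj : y ∉ (C j).toSubmodule := fun hy => hyS (hKS ⟨hy, hyT⟩)
  obtain ⟨c, hc⟩ := Submodule.exists_sub_smul_mem_of_finrank_le
    (A := (C j).toSubmodule) (M := (C (j + 1)).toSubmodule) (hmono j.le_succ)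
    (by
      have h1 := hdim j (by omega)
      have h2 := hdim (j + 1) hlast
      exact (h2.trans (congrArg (· + 1) h1.symm)).le)
    hyC hyj (lie_mem_right F L (C (j + 1)) z y hyC)
  exact ⟨c, hc, T.sub_mem (hT z hz y hyT) (T.smul_mem c hyT)⟩

/-- The vectors of a subspace `M` commuting with all of `M`. -/
def Submodule.lieCenter (M : Submodule F L) : Submodule F L where
  carrier := {m | m ∈ M ∧ ∀ m' ∈ M, ⁅m, m'⁆ = 0}
  zero_mem' := ⟨M.zero_mem, fun m' _ => zero_lie m'⟩
  add_mem' ha hb := ⟨M.add_mem ha.1 hb.1, fun m' hm' => by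
    rw [add_lie, ha.2 m' hm', hb.2 m' hm', add_zero]⟩
  smul_mem' c _ ha := ⟨M.smul_mem c ha.1, fun m' hm' => by
    rw [smul_lie, ha.2 m' hm', smul_zero]⟩

theorem lie_eq_zero_of_mem_sup_span_singleton {A : Submodule F L} {y : L}
    (hA : ∀ a ∈ A, ∀ b ∈ A, ⁅a, b⁆ = 0) (hy : ∀ a ∈ A, ⁅a, y⁆ = 0) :
    ∀ a ∈ A ⊔ F ∙ y, ∀ b ∈ A ⊔ F ∙ y, ⁅a, b⁆ = 0 := by
  have hy' : ∀ a ∈ A, ⁅y, a⁆ = 0 := fun a ha => by rw [← lie_skew, hy a ha, neg_zero]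
  intro u hu v hv
  obtain ⟨a, ha, w, hw, rfl⟩ := Submodule.mem_sup.1 hu
  obtain ⟨c, rfl⟩ := Submodule.mem_span_singleton.1 hw
  obtain ⟨b, hb, w', hw', rfl⟩ := Submodule.mem_sup.1 hv
  obtain ⟨d, rfl⟩ := Submodule.mem_span_singleton.1 hw'
  simp [hA a ha b hb, hy a ha, hy' b hb]

/-- An abelian subspace of codimension at most one in a `P`-stable subspace `M` can be replaced by
a `P`-stable one of at least the same dimension. -/
theorem IsSupersolvable.exists_stable_abelian [FiniteDimensional F L]
    (hss : IsSupersolvable F L) {P M A : Submodule F L}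
    (hM : ∀ z ∈ P, ∀ m ∈ M, ⁅z, m⁆ ∈ M) (hAM : A ≤ M) (hA : ∀ a ∈ A, ∀ b ∈ A, ⁅a, b⁆ = 0)
    (hr : finrank F M ≤ finrank F A + 1) :
    ∃ I ≤ M, (∀ a ∈ I, ∀ b ∈ I, ⁅a, b⁆ = 0) ∧ (∀ z ∈ P, ∀ a ∈ I, ⁅z, a⁆ ∈ I) ∧
      finrank F A ≤ finrank F I := by
  by_cases hstab : ∀ z ∈ P, ∀ a ∈ A, ⁅z, a⁆ ∈ A
  · exact ⟨A, hAM, hA, hstab, le_rfl⟩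
  push Not at hstab
  obtain ⟨z, hz, a₀, ha₀, hx⟩ := hstab
  set x := ⁅z, a₀⁆ with hxdef
  have hxM : x ∈ M := hM z hz a₀ (hAM ha₀)
  have hbr : ∀ b ∈ A, ⁅x, b⁆ ∈ F ∙ ⁅a₀, x⁆ := by
    intro b hb
    obtain ⟨c, hc⟩ := Submodule.exists_sub_smul_mem_of_finrank_le hAM hr hxM hx
      (hM z hz b (hAM hb))
    have h1 := hA a₀ ha₀ _ hc
    rw [lie_sub, lie_smul, sub_eq_zero] at h1
    refine Submodule.mem_span_singleton.2 ⟨-c, ?_⟩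
    rw [hxdef, lie_lie, hA a₀ ha₀ b hb, lie_zero, h1, zero_sub, neg_smul]
  let f : A →ₗ[F] L := (LieModule.toEnd F L L x).comp A.subtype
  have hker : (LinearMap.ker f).map A.subtype ≤ M.lieCenter := by
    rintro _ ⟨b, hb, rfl⟩
    have hb' : ⁅x, (b : L)⁆ = 0 := hb
    refine ⟨hAM b.2, fun m hm => ?_⟩
    obtain ⟨c, hc⟩ := Submodule.exists_sub_smul_mem_of_finrank_le hAM hr hxM hx hm
    have h1 := hA _ b.2 _ hc
    rw [lie_sub, lie_smul, ← lie_skew (b : L) x, hb', neg_zero, smul_zero, sub_zero] at h1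
    exact h1
  have hrange : finrank F (LinearMap.range f) ≤ 1 := by
    refine (Submodule.finrank_mono (t := F ∙ ⁅a₀, x⁆) ?_).trans (finrank_span_le_card _ |>.trans ?_)
    · rintro _ ⟨b, rfl⟩
      exact hbr b b.2
    · simp
  have hcen : finrank F A ≤ finrank F M.lieCenter + 1 := by
    have h1 := LinearMap.finrank_range_add_finrank_ker f
    have h2 := Submodule.finrank_mono hker
    rw [Submodule.finrank_map_subtype_eq] at h2
    omega
  by_cases hle : M ≤ M.lieCenter
  · exact ⟨M, le_rfl, fun a ha => (hle ha).2, hM, Submodule.finrank_mono hAM⟩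
  obtain ⟨K, hK, -, y, hyM, hy, hyK⟩ := hss.exists_stable_section hM hle
  have hZM : M.lieCenter ≤ M := fun m hm => hm.1
  refine ⟨M.lieCenter ⊔ F ∙ y, sup_le hZM ((Submodule.span_singleton_le_iff_mem _ _).2 hyM),
    lie_eq_zero_of_mem_sup_span_singleton (fun a ha b hb => ha.2 b hb.1)
      (fun a ha => ha.2 y hyM), fun w hw u hu => ?_,
    hcen.trans (Submodule.finrank_sup_span_singleton hy).ge⟩
  obtain ⟨a, ha, v, hv, rfl⟩ := Submodule.mem_sup.1 hu
  obtain ⟨c, rfl⟩ := Submodule.mem_span_singleton.1 hv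
  rw [lie_add, lie_smul]
  refine add_mem (Submodule.mem_sup_left ⟨hM w hw a ha.1, fun m hm => ?_⟩)
    (Submodule.smul_mem _ _ ?_)
  · rw [lie_lie, ha.2 m hm, ha.2 _ (hM w hw m hm), lie_zero, sub_zero]
  · obtain ⟨d, hd⟩ := hyK w hw
    rw [← sub_add_cancel ⁅w, y⁆ (d • y)]
    exact Submodule.add_mem_sup (hK hd) (Submodule.mem_span_singleton.2 ⟨d, rfl⟩)

/-- The elements of a subalgebra `M` whose bracket with `y` stays in `M`. -/
def LieSubalgebra.lieStabilizer (M : LieSubalgebra F L) (y : L) : Submodule F L :=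
  M.toSubmodule ⊓ M.toSubmodule.comap (LieModule.toEnd F L L y : L →ₗ[F] L)

/-- An abelian subspace of codimension at most one in a subalgebra of codimension one can be
replaced by an abelian ideal of at least the same dimension. -/
theorem IsSupersolvable.exists_abelian_ideal_of_codim_one [FiniteDimensional F L]
    (hss : IsSupersolvable F L)
    (M : LieSubalgebra F L) (hMr : finrank F M + 1 = finrank F L) {A : Submodule F L}
    (hAM : A ≤ M.toSubmodule) (hA : ∀ a ∈ A, ∀ b ∈ A, ⁅a, b⁆ = 0)
    (hr : finrank F M ≤ finrank F A + 1) :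
    ∃ I : Submodule F L, (∀ a ∈ I, ∀ b ∈ I, ⁅a, b⁆ = 0) ∧ (∀ z : L, ∀ a ∈ I, ⁅z, a⁆ ∈ I) ∧
      finrank F A ≤ finrank F I := by
  obtain ⟨A₁, hA₁M, hA₁, hstab, hAA₁⟩ := hss.exists_stable_abelian (P := M.toSubmodule)
    (fun z hz m hm => M.lie_mem hz hm) hAM hA hr
  suffices ∃ T A' : Submodule F L, (∀ z : L, ∀ m ∈ T, ⁅z, m⁆ ∈ T) ∧ A' ≤ T ∧
      (∀ a ∈ A', ∀ b ∈ A', ⁅a, b⁆ = 0) ∧ finrank F T ≤ finrank F A' + 1 ∧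
      finrank F A₁ ≤ finrank F A' by
    obtain ⟨T, A', hT, hA'T, hA', hTr, hA'r⟩ := this
    obtain ⟨I, -, hI, hIs, hIr⟩ := hss.exists_stable_abelian (P := ⊤) (fun z _ => hT z) hA'T hA' hTr
    exact ⟨I, hI, fun z => hIs z trivial, by omega⟩
  have hnle : ¬ (⊤ : Submodule F L) ≤ M.toSubmodule := fun h => by
    have h1 := Submodule.finrank_mono h
    rw [finrank_top] at h1
    change finrank F L ≤ finrank F M at h1
    omega
  obtain ⟨K, hKM, hKs, y, -, hyM, hyK⟩ := hss.exists_stable_section (P := ⊤)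
    (T := ⊤) (fun _ _ _ _ => trivial) hnle
  have hsplit (z : L) : ∃ c : F, z - c • y ∈ M := by
    refine Submodule.exists_sub_smul_mem_of_finrank_le (A := M.toSubmodule) le_top ?_
      (Submodule.mem_top (x := y)) hyM Submodule.mem_top
    rw [finrank_top]
    exact hMr.ge
  set N : Submodule F L := M.lieStabilizer y
  have hNM : N ≤ M.toSubmodule := inf_le_left
  have hKN : K ≤ N := fun k hk => ⟨hKM hk, hKM (hKs y trivial k hk)⟩
  have hyN : ∀ n ∈ N, ⁅y, n⁆ ∈ N := by
    intro n hn
    obtain ⟨c, hc⟩ := hyK n trivial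
    have h1 : ⁅y, n⁆ ∈ M := hn.2
    have h2 : c • y ∈ M := by
      have := M.neg_mem (M.add_mem h1 (hKM hc))
      rw [← lie_skew] at this
      simpa using this
    have hc0 : c = 0 := by
      by_contra hc0
      exact hyM ((M.toSubmodule.smul_mem_iff hc0).1 h2)
    rw [hc0, zero_smul, sub_zero] at hc
    rw [← lie_skew]
    exact N.neg_mem (hKN hc)
  have hMN : ∀ m ∈ M, ∀ n ∈ N, ⁅m, n⁆ ∈ N := by
    intro m hm n hn
    refine ⟨M.lie_mem hm hn.1, ?_⟩
    change ⁅y, ⁅m, n⁆⁆ ∈ M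
    obtain ⟨c, hc⟩ := hyK m trivial
    rw [leibniz_lie, ← lie_skew y m, ← sub_add_cancel ⁅m, y⁆ (c • y), neg_lie, add_lie, smul_lie]
    exact M.add_mem (M.neg_mem (M.add_mem (M.lie_mem (hKM hc) hn.1) (M.smul_mem c hn.2)))
      (M.lie_mem hm hn.2)
  have hN (z : L) : ∀ n ∈ N, ⁅z, n⁆ ∈ N := by
    intro n hn
    obtain ⟨c, hc⟩ := hsplit z
    rw [← sub_add_cancel z (c • y), add_lie, smul_lie]
    exact N.add_mem (hMN _ hc n hn) (N.smul_mem c (hyN n hn))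
  have hNr : finrank F N ≤ finrank F M := Submodule.finrank_mono hNM
  by_cases hA₁N : A₁ ≤ N
  · exact ⟨N, A₁, hN, hA₁N, hA₁, by omega, le_rfl⟩
  obtain ⟨t, htA, htN⟩ := SetLike.not_le_iff_exists.1 hA₁N
  have htM : t ∈ M := hA₁M htA
  have hNlt : finrank F N < finrank F M :=
    Submodule.finrank_lt_finrank_of_lt (lt_of_le_of_ne hNM fun h => htN (h ▸ htM))
  obtain ⟨c, hc⟩ := hyK t trivial
  have hc0 : c ≠ 0 := by
    rintro rfl
    rw [zero_smul, sub_zero] at hc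
    refine htN ⟨htM, ?_⟩
    change ⁅y, t⁆ ∈ M
    rw [← lie_skew]
    exact M.neg_mem (hKM hc)
  have htt : ∀ n ∈ N, ⁅t, ⁅t, n⁆⁆ = 0 := fun n hn => by
    have h1 := hstab n (hNM hn) t htA
    rw [← lie_skew t n, lie_neg, hA₁ t htA _ h1, neg_zero]
  -- `y₁` is an eigenvector of `ad t` for the eigenvalue `c`.
  set k := ⁅t, y⁆ - c • y with hk
  have hkN : k ∈ N := hKN hc
  set y₁ := y + (c⁻¹ • k + (c⁻¹ * c⁻¹) • ⁅t, k⁆) with hy₁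
  have hdiff : c⁻¹ • k + (c⁻¹ * c⁻¹) • ⁅t, k⁆ ∈ N :=
    N.add_mem (N.smul_mem _ hkN) (N.smul_mem _ (hN t k hkN))
  have hty₁ : ⁅t, y₁⁆ = c • y₁ := by
    have h1 : ⁅t, y⁆ = c • y + k := by rw [hk]; abel
    rw [hy₁, lie_add, lie_add, lie_smul, lie_smul, htt k hkN, h1, smul_add, smul_add, smul_smul,
      smul_smul, mul_inv_cancel₀ hc0, mul_inv_cancel_left₀ hc0, one_smul, smul_zero, add_zero,
      add_assoc]
  have hy₁N : y₁ ∉ N := fun h => hyM (hNM ((N.add_mem_iff_left hdiff).1 h))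
  have hcomm : ∀ b ∈ A₁ ⊓ N, ⁅b, y₁⁆ = 0 := by
    intro b hb
    have hw : ⁅b, y₁⁆ ∈ N := by
      rw [← lie_skew]
      exact N.neg_mem (hN y₁ b hb.2)
    have h1 : ⁅t, ⁅b, y₁⁆⁆ = c • ⁅b, y₁⁆ := by
      rw [leibniz_lie, hA₁ t htA b hb.1, zero_lie, zero_add, hty₁, lie_smul]
    have h2 := htt _ hw
    rw [h1, lie_smul, h1, smul_smul] at h2
    exact (smul_eq_zero.1 h2).resolve_left (mul_ne_zero hc0 hc0)
  refine ⟨N ⊔ F ∙ y₁, (A₁ ⊓ N) ⊔ F ∙ y₁, fun z u hu => ?_, sup_le_sup_right inf_le_right _,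
    lie_eq_zero_of_mem_sup_span_singleton (fun a ha b hb => hA₁ a ha.1 b hb.1) hcomm, ?_⟩
  · obtain ⟨n, hn, v, hv, rfl⟩ := Submodule.mem_sup.1 hu
    obtain ⟨d, rfl⟩ := Submodule.mem_span_singleton.1 hv
    rw [lie_add, lie_smul]
    refine add_mem (Submodule.mem_sup_left (hN z n hn)) (Submodule.smul_mem _ _ ?_)
    obtain ⟨e, he⟩ := hyK z trivial
    have h1 : ⁅z, y₁⁆ = ((⁅z, y⁆ - e • y) - e • (y₁ - y) + ⁅z, y₁ - y⁆) + e • y₁ := by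
      rw [lie_sub, smul_sub]; abel
    have h2 : y₁ - y ∈ N := by rw [hy₁, add_sub_cancel_left]; exact hdiff
    rw [h1]
    exact Submodule.add_mem_sup
      (N.add_mem (N.sub_mem (hKN he) (N.smul_mem _ h2)) (hN z _ h2))
      (Submodule.mem_span_singleton.2 ⟨e, rfl⟩)
  · have hle : A₁ ≤ (A₁ ⊓ N) ⊔ F ∙ t := by
      intro a ha
      obtain ⟨d, hd⟩ := hyK a trivial
      have h1 : a - (d * c⁻¹) • t ∈ A₁ ⊓ N := by
        refine ⟨A₁.sub_mem ha (A₁.smul_mem _ htA), M.sub_mem (hA₁M ha) (M.smul_mem _ htM), ?_⟩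
        change ⁅y, a - (d * c⁻¹) • t⁆ ∈ M
        have h2 : ⁅y, a - (d * c⁻¹) • t⁆ = -(⁅a, y⁆ - d • y) + (d * c⁻¹) • k := by
          rw [hk, smul_sub, smul_smul, inv_mul_cancel_right₀ hc0, lie_sub, lie_smul,
            ← lie_skew y a, ← lie_skew y t, smul_neg]
          abel
        rw [h2]
        exact M.add_mem (M.neg_mem (hKM hd)) (M.smul_mem _ (hKM hc))
      rw [← sub_add_cancel a ((d * c⁻¹) • t)]
      exact Submodule.add_mem_sup h1 (Submodule.mem_span_singleton.2 ⟨_, rfl⟩)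
    have h1 := Submodule.finrank_mono hle
    rw [Submodule.finrank_sup_span_singleton (p := A₁ ⊓ N) fun h => htN h.2] at h1
    rw [Submodule.finrank_sup_span_singleton hy₁N,
      Submodule.finrank_sup_span_singleton (p := A₁ ⊓ N) fun h => hy₁N h.2]
    omega

/-- In a supersolvable Lie algebra, an abelian subalgebra of codimension two can be replaced by an
abelian ideal of at least the same dimension. -/
theorem IsSupersolvable.exists_abelian_ideal_of_codim_two [FiniteDimensional F L]
    (hss : IsSupersolvable F L)
    (A : LieSubalgebra F L) (hA : IsLieAbelian A) (hr : finrank F A + 2 = finrank F L) :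
    ∃ I : LieIdeal F L, IsLieAbelian I ∧ finrank F A ≤ finrank F I := by
  have hA' : ∀ a ∈ A.toSubmodule, ∀ b ∈ A.toSubmodule, ⁅a, b⁆ = 0 := fun a ha b hb =>
    congrArg Subtype.val (trivial_lie_zero A A ⟨a, ha⟩ ⟨b, hb⟩)
  have hnle : ¬ (⊤ : Submodule F L) ≤ A.toSubmodule := fun h => by
    have h1 := Submodule.finrank_mono h
    rw [finrank_top] at h1
    change finrank F L ≤ finrank F A at h1
    omega
  obtain ⟨K, hKA, -, y, -, hyA, hyK⟩ := hss.exists_stable_section (P := ⊤)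
    (T := ⊤) (fun _ _ _ _ => trivial) hnle
  have hle : A.toSubmodule ≤ A.toSubmodule ⊔ F ∙ y := le_sup_left
  have hy : y ∈ A.toSubmodule ⊔ F ∙ y :=
    Submodule.mem_sup_right (Submodule.mem_span_singleton_self y)
  have hay : ∀ a ∈ A, ⁅a, y⁆ ∈ A.toSubmodule ⊔ F ∙ y := fun a _ => by
    obtain ⟨c, hc⟩ := hyK a trivial
    rw [← sub_add_cancel ⁅a, y⁆ (c • y)]
    exact add_mem (hle (hKA hc)) (Submodule.smul_mem _ c hy)
  let M : LieSubalgebra F L :=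
    { A.toSubmodule ⊔ F ∙ y with
      lie_mem' := by
        intro u v hu hv
        obtain ⟨a, ha, w, hw, rfl⟩ := Submodule.mem_sup.1 hu
        obtain ⟨c, rfl⟩ := Submodule.mem_span_singleton.1 hw
        obtain ⟨b, hb, w', hw', rfl⟩ := Submodule.mem_sup.1 hv
        obtain ⟨d, rfl⟩ := Submodule.mem_span_singleton.1 hw'
        have h1 : ⁅a + c • y, b + d • y⁆ = d • ⁅a, y⁆ - c • ⁅b, y⁆ := by
          simp only [lie_add, add_lie, lie_smul, smul_lie, hA' a ha b hb, lie_self]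
          rw [← lie_skew y b, smul_neg, smul_zero, add_zero, zero_add]
          abel
        change ⁅a + c • y, b + d • y⁆ ∈ A.toSubmodule ⊔ F ∙ y
        rw [h1]
        exact sub_mem (Submodule.smul_mem _ d (hay a ha)) (Submodule.smul_mem _ c (hay b hb)) }
  have hMr : finrank F M = finrank F A + 1 :=
    Submodule.finrank_sup_span_singleton hyA
  obtain ⟨I, hI, hIs, hIr⟩ := hss.exists_abelian_ideal_of_codim_one M (by omega)
    (A := A.toSubmodule) hle hA' hMr.le
  refine ⟨{ I with lie_mem := fun {z a} ha => hIs z a ha }, ⟨fun a b => ?_⟩, hIr⟩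
  exact Subtype.ext (hI a a.2 b b.2)

end Helpers

/-- If `L` is a finite-dimensional supersolvable Lie algebra of
dimension `n` with `α(L) = n − 2`, then `β(L) = n − 2`. -/
theorem betaInv_eq_of_supersolvable_alpha_n_sub_two (F L : Type*) [Field F] [LieRing L]
    [LieAlgebra F L] [FiniteDimensional F L] (hss : IsSupersolvable F L)
    (n : ℕ) (hn : Module.finrank F L = n) (halpha : alphaInv F L + 2 = n) :
    betaInv F L + 2 = n := by
  have hbA : BddAbove {d | ∃ A : LieSubalgebra F L, IsLieAbelian A ∧ finrank F A = d} :=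
    ⟨finrank F L, by rintro _ ⟨A, -, rfl⟩; exact A.toSubmodule.finrank_le⟩
  have hbI : BddAbove {d | ∃ I : LieIdeal F L, IsLieAbelian I ∧ finrank F I = d} :=
    ⟨finrank F L, by rintro _ ⟨I, -, rfl⟩; exact I.toSubmodule.finrank_le⟩
  obtain ⟨A, hA, hAr⟩ : alphaInv F L ∈
      {d | ∃ A : LieSubalgebra F L, IsLieAbelian A ∧ finrank F A = d} :=
    Nat.sSup_mem ⟨_, ⊥, ⟨fun a b => Subtype.ext ((LieSubalgebra.mem_bot _).1 ⁅a, b⁆.2)⟩, rfl⟩ hbA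
  obtain ⟨I, hI, hIr⟩ := hss.exists_abelian_ideal_of_codim_two A hA (by omega)
  have hge : finrank F I ≤ betaInv F L := le_csSup hbI ⟨I, hI, rfl⟩
  have hle : betaInv F L ≤ alphaInv F L :=
    csSup_le ⟨_, I, hI, rfl⟩ fun _ ⟨J, hJ, hJr⟩ => le_csSup hbA ⟨J.toLieSubalgebra, hJ, hJr⟩
  omega
end
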